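/- arXiv:1705.07068 — 2 statements merged into one kernel-verified Lean document; each statement's English description precedes it below -/
import Mathlib

section
/- There exist constants C, c > 0 such that for every ν ∈ ℕ, setting N = 2ν+1: (a) |h_ν(x)| ≤ C (N^{1/3} + |x² − N|)^{−1/4} for all x ∈ ℝ; (b) |h_ν(x)| ≤ C exp(−c x²) whenever x² ≥ 2N. -/
noncomputable section

/-- The `ν`-th Hermite function
`h_ν(x) = (−1)^ν (ν! 2^ν √π)^{−1/2} e^{x²/2} (d/dx)^ν e^{−x²}`. -/
def hermiteFn (ν : ℕ) (x : ℝ) : ℝ :=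
  (-1:ℝ)^ν * (Real.sqrt ((Nat.factorial ν : ℝ) * 2^ν * Real.sqrt Real.pi))⁻¹ *
    Real.exp (x^2/2) * iteratedDeriv ν (fun y => Real.exp (-y^2)) x

section HermiteBounds

open Filter Topology

/-- In the oscillatory region the WKB energy of a solution of `D²h = (x² - m⁶) h` stays bounded.
The correction term `x h k / r³`, with `r = √(m⁶ - x²)`, makes it almost monotone. -/
lemma wkb_energy_le (m : ℝ) (hm : 1 ≤ m) (h k : ℝ → ℝ)
    (hh : ∀ x, HasDerivAt h (k x) x) (hk : ∀ x, HasDerivAt k ((x^2 - m^6) * h x) x)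
    (h0 : m^3 * h 0 ^ 2 + k 0 ^ 2 / m^3 ≤ 4) (x : ℝ) (hx : 0 ≤ x) (hxm : x^2 ≤ m^6 - m^2) :
    √(m^6 - x^2) * h x ^ 2 + k x ^ 2 / √(m^6 - x^2) ≤ 24 := by
  set r : ℝ → ℝ := fun t => √(m^6 - t^2) with hr
  have hm0 : 0 < m := by linarith
  have hI : ∀ t ∈ Set.Icc 0 x, 0 ≤ t ∧ m ≤ r t ∧ r t ^ 2 = m^6 - t^2 ∧ t ≤ r t ^ 3 := by
    intro t ht
    have h1 : t^2 ≤ x^2 := pow_le_pow_left₀ ht.1 ht.2 2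
    have h2 : m ≤ r t := Real.le_sqrt_of_sq_le (by linarith)
    refine ⟨ht.1, h2, Real.sq_sqrt (by nlinarith), ?_⟩
    have h3 : t ≤ m^3 := by
      apply le_of_sq_le_sq _ (by positivity)
      nlinarith
    exact h3.trans (pow_le_pow_left₀ hm0.le h2 3)
  set G : ℝ → ℝ := fun t => r t * h t ^ 2 + k t ^ 2 / r t - t / r t ^ 3 * (h t * k t) with hG
  set S : ℝ → ℝ := fun t => r t * h t ^ 2 + k t ^ 2 / r t with hS
  have hhk : ∀ t ∈ Set.Icc 0 x, |h t * k t| ≤ S t / 2 := by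
    intro t ht
    obtain ⟨-, h2, -, -⟩ := hI t ht
    have h3 : 0 < r t := by linarith
    have e : S t = (r t ^ 2 * h t ^ 2 + k t ^ 2) / r t := by simp only [hS]; field_simp
    rw [abs_le, e]
    constructor
    · rw [neg_le, div_div, le_div_iff₀ (by positivity)]
      nlinarith [sq_nonneg (r t * h t + k t)]
    · rw [div_div, le_div_iff₀ (by positivity)]
      nlinarith [sq_nonneg (r t * h t - k t)]
  have hGS : ∀ t ∈ Set.Icc 0 x, S t / 2 ≤ G t := by
    intro t ht
    obtain ⟨h1, h2, -, h4⟩ := hI t ht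
    have h3 : 0 < r t := by linarith
    have h5 : t / r t ^ 3 ≤ 1 := by rw [div_le_one (by positivity)]; exact h4
    have h6 : 0 ≤ t / r t ^ 3 := by positivity
    have h7 : t / r t ^ 3 * (h t * k t) ≤ |h t * k t| := by
      nlinarith [le_abs_self (h t * k t), abs_nonneg (h t * k t)]
    have := hhk t ht
    have e : G t = S t - t / r t ^ 3 * (h t * k t) := rfl
    linarith
  have hrd : ∀ t ∈ Set.Icc 0 x, HasDerivAt r (-t / r t) t := by
    intro t ht
    obtain ⟨h1, h2, h3, h4⟩ := hI t ht
    have h5 : 0 < r t := by linarith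
    have := (((hasDerivAt_pow 2 t).const_sub (m^6)).sqrt (by nlinarith))
    convert this using 1
    simp only [hr]
    field_simp
    ring
  have hβ : ∀ t ∈ Set.Icc 0 x,
      HasDerivAt (fun t => t / r t ^ 3) (1 / r t ^ 3 + 3 * t^2 / r t ^ 5) t := by
    intro t ht
    obtain ⟨h1, h2, h3, h4⟩ := hI t ht
    have h5 : 0 < r t := by linarith
    have h6 : HasDerivAt (fun t => r t ^ 3) (3 * r t ^ 2 * (-t / r t)) t := by
      simpa using (hrd t ht).fun_pow 3
    refine ((hasDerivAt_id' t).fun_div h6 (by positivity)).congr_deriv ?_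
    field_simp
    ring
  have hGd : ∀ t ∈ Set.Icc 0 x,
      HasDerivAt G (-(1 / r t ^ 3 + 3 * t^2 / r t ^ 5) * (h t * k t)) t := by
    intro t ht
    obtain ⟨h1, h2, h3, h4⟩ := hI t ht
    have h5 : 0 < r t := by linarith
    have h6 : t^2 - m^6 = - r t ^ 2 := by linarith
    have hk' := hk t
    rw [h6] at hk'
    refine ((((hrd t ht).fun_mul ((hh t).fun_pow 2)).fun_add
      ((hk'.fun_pow 2).fun_div (hrd t ht) h5.ne')).fun_sub
      ((hβ t ht).fun_mul ((hh t).fun_mul hk'))).congr_deriv ?_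
    field_simp
    ring
  have hanti : AntitoneOn (fun t => G t * Real.exp (-(t / r t ^ 3))) (Set.Icc 0 x) := by
    have hd : ∀ t ∈ Set.Icc 0 x, HasDerivAt (fun t => G t * Real.exp (-(t / r t ^ 3)))
      ((-(1 / r t ^ 3 + 3 * t^2 / r t ^ 5) * (h t * k t)) * Real.exp (-(t / r t ^ 3))
        + G t * (Real.exp (-(t / r t ^ 3)) * -(1 / r t ^ 3 + 3 * t^2 / r t ^ 5))) t :=
      fun t ht => (hGd t ht).mul (hβ t ht).neg.exp
    apply antitoneOn_of_deriv_nonpos (convex_Icc 0 x)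
    · exact fun t ht => (hd t ht).continuousAt.continuousWithinAt
    · exact fun t ht => (hd t (interior_subset ht)).differentiableAt.differentiableWithinAt
    · intro t ht
      replace ht := interior_subset ht
      rw [(hd t ht).deriv]
      obtain ⟨h1, h2, h3, h4⟩ := hI t ht
      have h5 : 0 < r t := by linarith
      have h6 : 0 ≤ 1 / r t ^ 3 + 3 * t^2 / r t ^ 5 := by positivity
      have h7 : 0 ≤ h t * k t + G t := by
        linarith [neg_abs_le (h t * k t), hhk t ht, hGS t ht]
      have := mul_nonneg (mul_nonneg h6 (Real.exp_nonneg (-(t / r t ^ 3)))) h7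
      linarith
  have hx0 := hanti (Set.left_mem_Icc.2 hx) (Set.right_mem_Icc.2 hx) hx
  have hxI := Set.right_mem_Icc.2 hx
  obtain ⟨h1, h2, h3, h4⟩ := hI x hxI
  have h5 : 0 < r x := by linarith
  have hr0 : r 0 = m^3 := by
    simp only [hr]
    rw [show m^6 - 0^2 = (m^3)^2 by ring, Real.sqrt_sq (by positivity)]
  have hG0 : G 0 ≤ 4 := by simp only [hG, hr0]; simpa using h0
  have hx1 : G x * Real.exp (-(x / r x ^ 3)) ≤ 4 := by
    refine hx0.trans ?_
    simpa using hG0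
  have h6 : Real.exp (-1) ≤ Real.exp (-(x / r x ^ 3)) := by
    apply Real.exp_le_exp.2
    rw [neg_le_neg_iff, div_le_one (by positivity)]; exact h4
  have h7 : (1/3 : ℝ) ≤ Real.exp (-1) := by
    rw [Real.exp_neg, one_div]
    apply inv_anti₀ (Real.exp_pos 1)
    linarith [Real.exp_one_lt_d9]
  have h8 : 0 ≤ S x := by simp only [hS]; positivity
  have h9 := hGS x hxI
  have : S x / 2 * (1/3) ≤ 4 :=
    (mul_le_mul h9 (h7.trans h6) (by norm_num) (by linarith)).trans hx1
  change S x ≤ 24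
  linarith

/-- Bounds in the transition region just below the turning point `m³`. -/
lemma transition_bounds (m : ℝ) (hm : 1 ≤ m) (h k : ℝ → ℝ)
    (hh : ∀ x, HasDerivAt h (k x) x) (hk : ∀ x, HasDerivAt k ((x^2 - m^6) * h x) x)
    (h0 : m^3 * h 0 ^ 2 + k 0 ^ 2 / m^3 ≤ 4) (x : ℝ) (hx : 0 ≤ x) (hxl : m^6 - m^2 ≤ x^2)
    (hxr : x ≤ m^3) : k x ^ 2 ≤ 24 * m ∧ m * h x ^ 2 ≤ 96 := by
  have hm0 : 0 < m := by linarith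
  have hm26 : m^2 ≤ m^6 := pow_le_pow_right₀ hm (by norm_num)
  set a := √(m^6 - m^2) with ha
  have ha2 : a^2 = m^6 - m^2 := Real.sq_sqrt (by linarith)
  have ha0 : 0 ≤ a := Real.sqrt_nonneg _
  have hax : a ≤ x := Real.sqrt_le_iff.2 ⟨hx, hxl⟩
  have hS := wkb_energy_le m hm h k hh hk h0 a ha0 ha2.le
  rw [show m^6 - a^2 = m^2 by linarith, Real.sqrt_sq hm0.le] at hS
  have hS2 : m^2 * h a ^ 2 + k a ^ 2 ≤ 24 * m := by
    have := mul_le_mul_of_nonneg_left hS hm0.le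
    have e : m * (m * h a ^ 2 + k a ^ 2 / m) = m^2 * h a ^ 2 + k a ^ 2 := by field_simp
    linarith
  have hd : ∀ t, HasDerivAt (fun t => (m^6 - t^2) * h t ^ 2 + k t ^ 2) (-2 * t * h t ^ 2) t := by
    intro t
    refine ((((hasDerivAt_pow 2 t).const_sub (m^6)).fun_mul ((hh t).fun_pow 2)).fun_add
      ((hk t).fun_pow 2)).congr_deriv ?_
    push_cast
    ring
  have hanti : AntitoneOn (fun t => (m^6 - t^2) * h t ^ 2 + k t ^ 2) (Set.Ici 0) := by
    apply antitoneOn_of_deriv_nonpos (convex_Ici 0)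
    · exact fun t _ => (hd t).continuousAt.continuousWithinAt
    · exact fun t _ => (hd t).differentiableAt.differentiableWithinAt
    · intro t ht
      rw [(hd t).deriv]
      have : 0 ≤ t := interior_subset ht
      have : 0 ≤ t * h t ^ 2 := by positivity
      linarith
  have hkt : ∀ t ∈ Set.Icc a x, k t ^ 2 ≤ 24 * m := by
    intro t ht
    have ht0 : 0 ≤ t := ha0.trans ht.1
    have h1 := hanti (Set.mem_Ici.2 ha0) (Set.mem_Ici.2 ht0) ht.1
    simp only [show m^6 - a^2 = m^2 by linarith] at h1
    have h2 : t^2 ≤ m^6 := by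
      calc t^2 ≤ (m^3)^2 := pow_le_pow_left₀ ht0 (ht.2.trans hxr) 2
        _ = m^6 := by ring
    have := mul_nonneg (sub_nonneg.2 h2) (sq_nonneg (h t))
    linarith
  refine ⟨hkt x ⟨hax, le_rfl⟩, ?_⟩
  have hdist : m * (x - a) ≤ 1 := by
    have h1 : (m^3 - a) * m^3 ≤ m^2 := by
      have : 0 ≤ (m^3 - a) * a := mul_nonneg (by linarith) ha0
      nlinarith
    have h2 : m^2 * (m * (m^3 - a)) ≤ m^2 * 1 := by linarith
    have h3 := le_of_mul_le_mul_left h2 (by positivity)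
    nlinarith
  have hlip : ‖h x - h a‖ ≤ √(24 * m) * ‖x - a‖ := by
    refine (convex_Icc a x).norm_image_sub_le_of_norm_hasDerivWithin_le
      (f' := k) (fun t _ => (hh t).hasDerivWithinAt) (fun t ht => ?_)
      (Set.left_mem_Icc.2 hax) (Set.right_mem_Icc.2 hax)
    rw [Real.norm_eq_abs]
    exact Real.abs_le_sqrt (hkt t ht)
  have hlip2 : (h x - h a)^2 ≤ 24 * m * (x - a)^2 := by
    have := pow_le_pow_left₀ (norm_nonneg _) hlip 2
    rwa [mul_pow, Real.sq_sqrt (by positivity), Real.norm_eq_abs, Real.norm_eq_abs, sq_abs,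
      sq_abs] at this
  have h3 : m * (h x - h a)^2 ≤ 24 := by
    have h4 : (m * (x - a))^2 ≤ 1 := by
      apply pow_le_one₀ (mul_nonneg hm0.le (by linarith)) hdist
    nlinarith [mul_le_mul_of_nonneg_left hlip2 hm0.le]
  have h5 : m * h a ^ 2 ≤ 24 := by
    have : 0 ≤ k a ^ 2 / m := by positivity
    linarith
  have h6 : h x ^ 2 ≤ 2 * (h x - h a)^2 + 2 * h a ^ 2 := by nlinarith [sq_nonneg (h x - 2 * h a)]
  nlinarith

/-- Beyond the turning point a solution of `D²h = (x² - n) h` vanishing at infinity has `h²`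
decreasing, with logarithmic derivative controlled by the energy. -/
lemma forbidden_region_bounds (n : ℝ) (b : ℝ) (hb : 0 ≤ b) (hbn : n ≤ b^2) (h k : ℝ → ℝ)
    (hh : ∀ x, HasDerivAt h (k x) x) (hk : ∀ x, HasDerivAt k ((x^2 - n) * h x) x)
    (hl1 : Tendsto (fun x => h x * k x) atTop (𝓝 0))
    (hl2 : Tendsto (fun x => k x ^ 2 - (x^2 - n) * h x ^ 2) atTop (𝓝 0)) :
    AntitoneOn (fun x => h x ^ 2) (Set.Ici b) ∧ MonotoneOn (fun x => h x * k x) (Set.Ici b) ∧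
    ∀ x, b ≤ x → √(x^2 - n) * h x ^ 2 ≤ -(h x * k x) := by
  have hpos : ∀ t ∈ Set.Ici b, 0 ≤ t^2 - n := fun t ht =>
    sub_nonneg.2 (hbn.trans (pow_le_pow_left₀ hb ht 2))
  have hmono : MonotoneOn (fun x => h x * k x) (Set.Ici b) := by
    have hd := fun t => (hh t).fun_mul (hk t)
    apply monotoneOn_of_deriv_nonneg (convex_Ici b)
    · exact fun t _ => (hd t).continuousAt.continuousWithinAt
    · exact fun t _ => (hd t).differentiableAt.differentiableWithinAt
    · intro t ht
      rw [(hd t).deriv]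
      nlinarith [mul_nonneg (hpos t (interior_subset ht)) (sq_nonneg (h t)), sq_nonneg (k t)]
  have hneg : ∀ x, b ≤ x → h x * k x ≤ 0 := fun x hx =>
    ge_of_tendsto hl1 (eventually_atTop.2 ⟨x, fun y hy => hmono hx (hx.trans hy) hy⟩)
  have hanti : AntitoneOn (fun x => k x ^ 2 - (x^2 - n) * h x ^ 2) (Set.Ici 0) := by
    have hd : ∀ t, HasDerivAt (fun x => k x ^ 2 - (x^2 - n) * h x ^ 2) (-2 * t * h t ^ 2) t := by
      intro t
      refine (((hk t).fun_pow 2).fun_sub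
        (((hasDerivAt_pow 2 t).sub_const n).fun_mul ((hh t).fun_pow 2))).congr_deriv ?_
      push_cast
      ring
    apply antitoneOn_of_deriv_nonpos (convex_Ici 0)
    · exact fun t _ => (hd t).continuousAt.continuousWithinAt
    · exact fun t _ => (hd t).differentiableAt.differentiableWithinAt
    · intro t ht
      rw [(hd t).deriv]
      have : 0 ≤ t := interior_subset ht
      have : 0 ≤ t * h t ^ 2 := by positivity
      linarith
  refine ⟨?_, hmono, ?_⟩
  · have hd := fun t => (hh t).fun_pow 2
    apply antitoneOn_of_deriv_nonpos (convex_Ici b)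
    · exact fun t _ => (hd t).continuousAt.continuousWithinAt
    · exact fun t _ => (hd t).differentiableAt.differentiableWithinAt
    · intro t ht
      rw [(hd t).deriv]
      have := hneg t (interior_subset ht)
      simp
      linarith
  · intro x hx
    have h1 : 0 ≤ k x ^ 2 - (x^2 - n) * h x ^ 2 :=
      le_of_tendsto hl2 (eventually_atTop.2 ⟨x, fun y hy =>
        hanti (hb.trans hx) ((hb.trans hx).trans hy) hy⟩)
    apply le_of_sq_le_sq _ (by linarith [hneg x hx])
    rw [mul_pow, Real.sq_sqrt (hpos x hx)]
    nlinarith [mul_nonneg h1 (sq_nonneg (h x))]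

lemma gaussian_decay (n : ℝ) (hn : 0 ≤ n) (h k : ℝ → ℝ) (hh : ∀ x, HasDerivAt h (k x) x)
    (hle : ∀ x, √n ≤ x → √(x^2 - n) * h x ^ 2 ≤ -(h x * k x)) (x : ℝ) (hx : 0 ≤ x)
    (hxn : 2 * n ≤ x^2) : h x ^ 2 ≤ h (√(3 / 2 * n)) ^ 2 * Real.exp (-(x^2 / 8)) := by
  set a := √(3 / 2 * n) with ha
  have ha2 : a^2 = 3 / 2 * n := Real.sq_sqrt (by positivity)
  have ha0 : 0 ≤ a := Real.sqrt_nonneg _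
  have hax : a ≤ x := Real.sqrt_le_iff.2 ⟨hx, by linarith⟩
  have hna : √n ≤ a := Real.sqrt_le_sqrt (by linarith)
  have hd : ∀ t, HasDerivAt (fun t => h t ^ 2 * Real.exp (t^2 / 2))
      ((2 * (h t * k t) + t * h t ^ 2) * Real.exp (t^2 / 2)) t := by
    intro t
    refine (((hh t).fun_pow 2).fun_mul (((hasDerivAt_pow 2 t).div_const 2).exp)).congr_deriv ?_
    push_cast
    ring
  have hanti : AntitoneOn (fun t => h t ^ 2 * Real.exp (t^2 / 2)) (Set.Ici a) := by
    apply antitoneOn_of_deriv_nonpos (convex_Ici a)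
    · exact fun t _ => (hd t).continuousAt.continuousWithinAt
    · exact fun t _ => (hd t).differentiableAt.differentiableWithinAt
    · intro t ht
      rw [(hd t).deriv]
      have hat : a ≤ t := interior_subset ht
      have h1 := hle t (hna.trans hat)
      have h2 : t / 2 ≤ √(t^2 - n) := by
        apply Real.le_sqrt_of_sq_le
        have := pow_le_pow_left₀ ha0 hat 2
        nlinarith
      have := mul_le_mul_of_nonneg_right h2 (sq_nonneg (h t))
      apply mul_nonpos_of_nonpos_of_nonneg _ (Real.exp_nonneg _)
      linarith
  have h1 := hanti (Set.self_mem_Ici) hax hax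
  have h2 : h x ^ 2 = h x ^ 2 * Real.exp (x^2 / 2) * Real.exp (-(x^2 / 2)) := by
    rw [mul_assoc, ← Real.exp_add]; simp
  rw [h2]
  calc _ ≤ h a ^ 2 * Real.exp (a^2 / 2) * Real.exp (-(x^2 / 2)) :=
        mul_le_mul_of_nonneg_right h1 (Real.exp_nonneg _)
    _ = h a ^ 2 * Real.exp (a^2 / 2 + -(x^2 / 2)) := by rw [mul_assoc, ← Real.exp_add]
    _ ≤ _ := by
        apply mul_le_mul_of_nonneg_left _ (sq_nonneg _)
        apply Real.exp_le_exp.2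
        linarith

lemma ode_bounds (m : ℝ) (hm : 1 ≤ m) (h k : ℝ → ℝ)
    (hh : ∀ x, HasDerivAt h (k x) x) (hk : ∀ x, HasDerivAt k ((x^2 - m^6) * h x) x)
    (h0 : m^3 * h 0 ^ 2 + k 0 ^ 2 / m^3 ≤ 4)
    (hl1 : Tendsto (fun x => h x * k x) atTop (𝓝 0))
    (hl2 : Tendsto (fun x => k x ^ 2 - (x^2 - m^6) * h x ^ 2) atTop (𝓝 0))
    (x : ℝ) (hx : 0 ≤ x) :
    √(m^2 + |x^2 - m^6|) * h x ^ 2 ≤ 150 ∧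
      (2 * m^6 ≤ x^2 → h x ^ 2 ≤ 150 * Real.exp (-(x^2 / 8))) := by
  have hm0 : 0 < m := by linarith
  have e6 : m^6 = (m^3)^2 := by ring
  have hm26 : m^2 ≤ m^6 := pow_le_pow_right₀ hm (by norm_num)
  obtain ⟨f1, f2, f3⟩ := forbidden_region_bounds (m^6) (m^3) (by positivity) e6.le h k hh hk hl1 hl2
  obtain ⟨t1, t2⟩ := transition_bounds m hm h k hh hk h0 (m^3) (by positivity)
    (by rw [← e6]; linarith [sq_nonneg m]) le_rfl
  have hsqrt : ∀ u v : ℝ, u ≤ 4 * v ^ 2 → 0 ≤ v → √u ≤ 2 * v := fun u v huv hv =>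
    Real.sqrt_le_iff.2 ⟨by positivity, by linarith⟩
  constructor
  · rcases le_total x (m^3) with hx3 | hx3
    · have hq : x^2 ≤ m^6 := by rw [e6]; exact pow_le_pow_left₀ hx hx3 2
      rw [abs_sub_comm, abs_of_nonneg (sub_nonneg.2 hq)]
      rcases le_total (x^2) (m^6 - m^2) with hc | hc
      · have := wkb_energy_le m hm h k hh hk h0 x hx hc
        have h1 : √(m^2 + (m^6 - x^2)) ≤ 2 * √(m^6 - x^2) := by
          apply hsqrt _ _ _ (Real.sqrt_nonneg _)
          rw [Real.sq_sqrt (by linarith)]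
          linarith [sq_nonneg m]
        have h2 := mul_le_mul_of_nonneg_right h1 (sq_nonneg (h x))
        have h3 : 0 ≤ k x ^ 2 / √(m^6 - x^2) := by positivity
        linarith
      · have := (transition_bounds m hm h k hh hk h0 x hx hc hx3).2
        have h1 : √(m^2 + (m^6 - x^2)) ≤ 3 / 2 * m :=
          Real.sqrt_le_iff.2 ⟨by positivity, by nlinarith⟩
        have h2 := mul_le_mul_of_nonneg_right h1 (sq_nonneg (h x))
        linarith
    · have hq : m^6 ≤ x^2 := by rw [e6]; exact pow_le_pow_left₀ (by positivity) hx3 2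
      rw [abs_of_nonneg (sub_nonneg.2 hq)]
      have h1 : √(m^2 + (x^2 - m^6)) ≤ m + √(x^2 - m^6) := by
        rw [Real.sqrt_le_iff]
        refine ⟨by positivity, ?_⟩
        have := Real.sq_sqrt (sub_nonneg.2 hq)
        nlinarith [Real.sqrt_nonneg (x^2 - m^6)]
      have h2 := mul_le_mul_of_nonneg_right h1 (sq_nonneg (h x))
      have h3 := mul_le_mul_of_nonneg_left (f1 Set.self_mem_Ici hx3 hx3) hm0.le
      have h4 := f2 Set.self_mem_Ici hx3 hx3
      have h5 := f3 x hx3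
      simp only at h3 h4
      have h6 : -(h (m^3) * k (m^3)) ≤ 48 := by
        apply le_of_sq_le_sq _ (by norm_num)
        have := mul_le_mul t2 t1 (sq_nonneg _) (by norm_num)
        have h7 : m * (h (m^3) * k (m^3))^2 ≤ m * 48^2 := by nlinarith
        rw [neg_sq]
        exact le_of_mul_le_mul_left h7 hm0
      linarith
  · intro hx2
    have hs : √(m^6) = m^3 := by rw [e6, Real.sqrt_sq (by positivity)]
    refine (gaussian_decay (m^6) (by positivity) h k hh (by rwa [hs]) x hx hx2).trans ?_
    apply mul_le_mul_of_nonneg_right _ (Real.exp_nonneg _)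
    have h1 : m^3 ≤ √(3 / 2 * m^6) := by
      rw [← hs]; exact Real.sqrt_le_sqrt (by linarith [sq_nonneg m])
    have h2 := f1 Set.self_mem_Ici h1 h1
    simp only at h2
    nlinarith [sq_nonneg (h (m^3))]

/-- The `n`-th derivative of `e^{-y²}`. -/
abbrev gaussDeriv (n : ℕ) : ℝ → ℝ := iteratedDeriv n (fun y => Real.exp (-y^2))

lemma hasDerivAt_gaussDeriv (n : ℕ) (x : ℝ) :
    HasDerivAt (gaussDeriv n) (gaussDeriv (n + 1) x) x := by
  have hc : ContDiff ℝ ⊤ (fun y : ℝ => Real.exp (-y^2)) := by fun_prop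
  have := (hc.differentiable_iteratedDeriv n (by exact_mod_cast WithTop.coe_lt_top _)) x
  unfold gaussDeriv
  rw [iteratedDeriv_succ]
  exact this.hasDerivAt

lemma gaussDeriv_zero (x : ℝ) : gaussDeriv 0 x = Real.exp (-x^2) := by
  simp [gaussDeriv]

lemma gaussDeriv_one (x : ℝ) : gaussDeriv 1 x = -2 * x * gaussDeriv 0 x := by
  have h1 : HasDerivAt (gaussDeriv 0) (-2 * x * gaussDeriv 0 x) x := by
    have e : gaussDeriv 0 = fun y => Real.exp (-y^2) := iteratedDeriv_zero
    rw [e]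
    refine ((hasDerivAt_pow 2 x).fun_neg.exp).congr_deriv ?_
    push_cast
    ring
  exact (hasDerivAt_gaussDeriv 0 x).unique h1

lemma gaussDeriv_add_two (n : ℕ) (x : ℝ) :
    gaussDeriv (n + 2) x = -2 * x * gaussDeriv (n + 1) x - 2 * (n + 1) * gaussDeriv n x := by
  induction n generalizing x with
  | zero =>
    have h1 := hasDerivAt_gaussDeriv 1 x
    rw [show gaussDeriv 1 = _ from funext gaussDeriv_one] at h1
    rw [h1.unique (((hasDerivAt_id' x).const_mul (-2)).fun_mul (hasDerivAt_gaussDeriv 0 x))]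
    push_cast
    ring
  | succ n ih =>
    have h1 := hasDerivAt_gaussDeriv (n + 2) x
    rw [show gaussDeriv (n + 2) = _ from funext ih] at h1
    rw [h1.unique ((((hasDerivAt_id' x).const_mul (-2)).fun_mul
      (hasDerivAt_gaussDeriv (n + 1) x)).fun_sub
      ((hasDerivAt_gaussDeriv n x).const_mul (2 * (n + 1 : ℝ))))]
    push_cast
    ring

lemma exists_gaussDeriv_eq_eval_mul_exp (n : ℕ) :
    ∃ P : Polynomial ℝ, ∀ x, gaussDeriv n x = P.eval x * Real.exp (-x^2) := by
  induction n with
  | zero => exact ⟨1, fun x => by rw [gaussDeriv_zero]; simp⟩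
  | succ n ih =>
    obtain ⟨P, hP⟩ := ih
    refine ⟨P.derivative - 2 * Polynomial.X * P, fun x => ?_⟩
    have h1 := hasDerivAt_gaussDeriv n x
    rw [show gaussDeriv n = _ from funext hP] at h1
    rw [h1.unique ((P.hasDerivAt x).fun_mul ((hasDerivAt_pow 2 x).fun_neg.exp))]
    simp
    ring

lemma gaussDeriv_neg (n : ℕ) (x : ℝ) : gaussDeriv n (-x) = (-1) ^ n * gaussDeriv n x := by
  have := iteratedDeriv_comp_neg n (fun y : ℝ => Real.exp (-y^2)) (-x)
  simpa using this

lemma tendsto_eval_mul_exp_neg_sq (P : Polynomial ℝ) :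
    Tendsto (fun x => P.eval x * Real.exp (-x^2)) atTop (𝓝 0) := by
  induction P using Polynomial.induction_on' with
  | add p q hp hq => simpa [add_mul] using hp.add hq
  | monomial n a =>
    have h1 : Tendsto (fun x : ℝ => x ^ n * Real.exp (-x^2)) atTop (𝓝 0) := by
      refine squeeze_zero' ?_ ?_ (Real.tendsto_pow_mul_exp_neg_atTop_nhds_zero n)
      · filter_upwards [eventually_ge_atTop 0] with x hx
        positivity
      · filter_upwards [eventually_ge_atTop 1] with x hx
        gcongr
        nlinarith
    simpa [mul_assoc] using h1.const_mul a

lemma gaussDeriv_zero_bound (n : ℕ) :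
    (n + 1) * (gaussDeriv n 0 ^ 2) ^ 2 ≤ ((n.factorial : ℝ) * 2 ^ n) ^ 2 := by
  induction n using Nat.twoStepInduction with
  | zero => simp [gaussDeriv_zero]
  | one => simp [gaussDeriv_one]
  | more n ih _ =>
    rw [gaussDeriv_add_two, Nat.factorial_succ, Nat.factorial_succ]
    push_cast
    have h1 : (n + 1 : ℝ) * (n + 3) ≤ (n + 2) ^ 2 := by nlinarith
    calc _ = 16 * ((n + 1 : ℝ) * (n + 3)) * (n + 1) ^ 2 *
          ((n + 1) * (gaussDeriv n 0 ^ 2) ^ 2) := by ring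
      _ ≤ 16 * (n + 2 : ℝ) ^ 2 * (n + 1) ^ 2 * ((n.factorial : ℝ) * 2 ^ n) ^ 2 := by gcongr
      _ = _ := by ring

lemma abs_hermiteFn_neg (ν : ℕ) (x : ℝ) : |hermiteFn ν (-x)| = |hermiteFn ν x| := by
  have := gaussDeriv_neg ν x
  simp only [gaussDeriv] at this
  simp [hermiteFn, this, abs_mul]

/-- The derivative of the Hermite function, written out. -/
def hermiteFnDeriv (ν : ℕ) (x : ℝ) : ℝ :=
  (-1:ℝ)^ν * (Real.sqrt ((Nat.factorial ν : ℝ) * 2^ν * Real.sqrt Real.pi))⁻¹ *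
    Real.exp (x^2/2) * (x * gaussDeriv ν x + gaussDeriv (ν + 1) x)

lemma hasDerivAt_hermiteFn (ν : ℕ) (x : ℝ) :
    HasDerivAt (hermiteFn ν) (hermiteFnDeriv ν x) x := by
  have h1 := ((((hasDerivAt_pow 2 x).div_const 2).exp).const_mul
    ((-1:ℝ)^ν * (Real.sqrt ((Nat.factorial ν : ℝ) * 2^ν * Real.sqrt Real.pi))⁻¹)).fun_mul
    (hasDerivAt_gaussDeriv ν x)
  refine h1.congr_deriv ?_
  unfold hermiteFnDeriv
  push_cast
  ring

lemma hasDerivAt_hermiteFnDeriv (ν : ℕ) (x : ℝ) :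
    HasDerivAt (hermiteFnDeriv ν) ((x^2 - (2 * ν + 1)) * hermiteFn ν x) x := by
  have h1 := ((((hasDerivAt_pow 2 x).div_const 2).exp).const_mul
    ((-1:ℝ)^ν * (Real.sqrt ((Nat.factorial ν : ℝ) * 2^ν * Real.sqrt Real.pi))⁻¹)).fun_mul
    (((hasDerivAt_id' x).fun_mul (hasDerivAt_gaussDeriv ν x)).fun_add
      (hasDerivAt_gaussDeriv (ν + 1) x))
  refine h1.congr_deriv ?_
  rw [gaussDeriv_add_two]
  unfold hermiteFn gaussDeriv
  push_cast
  ring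

lemma hermiteFn_eq_eval_mul_exp (ν : ℕ) : ∃ P Q : Polynomial ℝ, ∀ x,
    hermiteFn ν x = P.eval x * Real.exp (-(x^2 / 2)) ∧
      hermiteFnDeriv ν x = Q.eval x * Real.exp (-(x^2 / 2)) := by
  obtain ⟨P, hP⟩ := exists_gaussDeriv_eq_eval_mul_exp ν
  obtain ⟨Q, hQ⟩ := exists_gaussDeriv_eq_eval_mul_exp (ν + 1)
  set c := (-1:ℝ)^ν * (Real.sqrt ((Nat.factorial ν : ℝ) * 2^ν * Real.sqrt Real.pi))⁻¹ with hc
  refine ⟨Polynomial.C c * P, Polynomial.C c * (Polynomial.X * P + Q), fun x => ?_⟩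
  have e : Real.exp (-(x^2 / 2)) = Real.exp (x^2 / 2) * Real.exp (-x^2) := by
    rw [← Real.exp_add]; congr 1; ring
  constructor
  · change c * Real.exp (x^2/2) * gaussDeriv ν x = _
    rw [hP, e]
    simp only [Polynomial.eval_mul, Polynomial.eval_C]
    ring
  · change c * Real.exp (x^2/2) * (x * gaussDeriv ν x + gaussDeriv (ν + 1) x) = _
    rw [hP, hQ, e]
    simp only [Polynomial.eval_mul, Polynomial.eval_C, Polynomial.eval_add, Polynomial.eval_X]
    ring

lemma tendsto_hermiteFn_mul_deriv (ν : ℕ) :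
    Tendsto (fun x => hermiteFn ν x * hermiteFnDeriv ν x) atTop (𝓝 0) := by
  obtain ⟨P, Q, h⟩ := hermiteFn_eq_eval_mul_exp ν
  refine (tendsto_eval_mul_exp_neg_sq (P * Q)).congr fun x => ?_
  rw [(h x).1, (h x).2, show -x^2 = -(x^2 / 2) + -(x^2 / 2) by ring, Real.exp_add,
    Polynomial.eval_mul]
  ring

lemma tendsto_hermiteFn_energy (ν : ℕ) (n : ℝ) :
    Tendsto (fun x => hermiteFnDeriv ν x ^ 2 - (x^2 - n) * hermiteFn ν x ^ 2) atTop (𝓝 0) := by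
  obtain ⟨P, Q, h⟩ := hermiteFn_eq_eval_mul_exp ν
  refine (tendsto_eval_mul_exp_neg_sq
    (Q ^ 2 - (Polynomial.X ^ 2 - Polynomial.C n) * P ^ 2)).congr fun x => ?_
  rw [(h x).1, (h x).2, show -x^2 = -(x^2 / 2) + -(x^2 / 2) by ring, Real.exp_add]
  simp only [Polynomial.eval_mul, Polynomial.eval_C, Polynomial.eval_sub, Polynomial.eval_pow,
    Polynomial.eval_X]
  ring

lemma hermiteFn_energy_zero (ν : ℕ) (s : ℝ) (hs : 0 < s) (hsν : s ^ 2 = 2 * ν + 1) :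
    s * hermiteFn ν 0 ^ 2 + hermiteFnDeriv ν 0 ^ 2 / s ≤ 4 := by
  set w : ℝ := (Nat.factorial ν : ℝ) * 2^ν with hw
  have hw0 : 0 < w := by positivity
  have hpi : 1 ≤ √Real.pi := Real.one_le_sqrt.2 (by linarith [Real.pi_gt_three])
  have hc : (Real.sqrt (w * √Real.pi))⁻¹ ^ 2 ≤ w⁻¹ := by
    rw [inv_pow, Real.sq_sqrt (by positivity)]
    exact inv_anti₀ hw0 (le_mul_of_one_le_right hw0.le hpi)
  have hsgn : ((-1 : ℝ) ^ ν) ^ 2 = 1 := by rw [← pow_mul, mul_comm, pow_mul]; simp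
  have e1 : hermiteFn ν 0 ^ 2 ≤ w⁻¹ * gaussDeriv ν 0 ^ 2 := by
    have : hermiteFn ν 0 ^ 2 = (Real.sqrt (w * √Real.pi))⁻¹ ^ 2 * gaussDeriv ν 0 ^ 2 := by
      unfold hermiteFn gaussDeriv
      simp [mul_pow, hsgn, hw]
    rw [this]
    gcongr
  have e2 : hermiteFnDeriv ν 0 ^ 2 ≤ w⁻¹ * gaussDeriv (ν + 1) 0 ^ 2 := by
    have : hermiteFnDeriv ν 0 ^ 2 =
        (Real.sqrt (w * √Real.pi))⁻¹ ^ 2 * gaussDeriv (ν + 1) 0 ^ 2 := by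
      unfold hermiteFnDeriv
      simp [mul_pow, hsgn, hw]
    rw [this]
    gcongr
  have b1 : s * gaussDeriv ν 0 ^ 2 ≤ 2 * w := by
    apply le_of_sq_le_sq _ (by positivity)
    have := gaussDeriv_zero_bound ν
    rw [mul_pow, hsν]
    nlinarith [sq_nonneg (gaussDeriv ν 0 ^ 2)]
  have b2 : gaussDeriv (ν + 1) 0 ^ 2 ≤ 2 * w * s := by
    apply le_of_sq_le_sq _ (by positivity)
    have := gaussDeriv_zero_bound (ν + 1)
    rw [Nat.factorial_succ] at this
    push_cast at this
    have h1 : (ν + 2 : ℝ) * (gaussDeriv (ν + 1) 0 ^ 2) ^ 2 ≤ (ν + 2) * (2 * w * s) ^ 2 := by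
      calc _ = ((ν : ℝ) + 1 + 1) * (gaussDeriv (ν + 1) 0 ^ 2) ^ 2 := by ring
        _ ≤ _ := this
        _ = 4 * w ^ 2 * (ν + 1 : ℝ) ^ 2 := by rw [hw]; ring
        _ ≤ 4 * w ^ 2 * ((ν + 2) * (2 * ν + 1)) := by
            gcongr
            nlinarith [(Nat.cast_nonneg ν : (0:ℝ) ≤ ν)]
        _ = _ := by rw [← hsν]; ring
    exact le_of_mul_le_mul_left h1 (by positivity)
  have c1 : s * hermiteFn ν 0 ^ 2 ≤ 2 := by
    calc _ ≤ s * (w⁻¹ * gaussDeriv ν 0 ^ 2) := by gcongr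
      _ = w⁻¹ * (s * gaussDeriv ν 0 ^ 2) := by ring
      _ ≤ w⁻¹ * (2 * w) := by gcongr
      _ = 2 := by field_simp
  have c2 : hermiteFnDeriv ν 0 ^ 2 / s ≤ 2 := by
    rw [div_le_iff₀ hs]
    calc _ ≤ w⁻¹ * gaussDeriv (ν + 1) 0 ^ 2 := e2
      _ ≤ w⁻¹ * (2 * w * s) := by gcongr
      _ = 2 * s := by field_simp
  linarith

end HermiteBounds

/-- uniform bounds for Hermite functions: with `N = 2ν+1`,
`|h_ν(x)| ≤ C (N^{1/3} + |x²−N|)^{−1/4}` everywhere, and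
`|h_ν(x)| ≤ C e^{−cx²}` for `x² ≥ 2N`. -/
theorem statement10 :
    ∃ C c : ℝ, 0 < C ∧ 0 < c ∧ ∀ (ν : ℕ) (x : ℝ),
      |hermiteFn ν x| ≤
          C * ((2*(ν:ℝ)+1) ^ ((1:ℝ)/3) + |x^2 - (2*(ν:ℝ)+1)|) ^ (-(1:ℝ)/4) ∧
        (2 * (2*(ν:ℝ)+1) ≤ x^2 → |hermiteFn ν x| ≤ C * Real.exp (-c * x^2)) := by
  refine ⟨13, 1 / 16, by norm_num, by norm_num, fun ν x => ?_⟩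
  have hN1 : (1 : ℝ) ≤ 2 * ν + 1 := by linarith [(Nat.cast_nonneg ν : (0:ℝ) ≤ ν)]
  have hN0 : (0 : ℝ) ≤ 2 * ν + 1 := by linarith
  set m : ℝ := (2 * (ν:ℝ) + 1) ^ ((1:ℝ) / 6) with hm
  have hm1 : 1 ≤ m := Real.one_le_rpow hN1 (by norm_num)
  have hm6 : m ^ 6 = 2 * (ν:ℝ) + 1 := by
    rw [hm, ← Real.rpow_mul_natCast hN0]; norm_num
  have hm2 : (2 * (ν:ℝ) + 1) ^ ((1:ℝ) / 3) = m ^ 2 := by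
    rw [hm, ← Real.rpow_mul_natCast hN0]; norm_num
  have habs : |hermiteFn ν x| = |hermiteFn ν (|x|)| := by
    rcases abs_choice x with h | h <;> rw [h]
    exact (abs_hermiteFn_neg ν x).symm
  obtain ⟨h1, h2⟩ := ode_bounds m hm1 (hermiteFn ν) (hermiteFnDeriv ν) (hasDerivAt_hermiteFn ν)
    (by rw [hm6]; exact hasDerivAt_hermiteFnDeriv ν)
    (hermiteFn_energy_zero ν (m ^ 3) (by positivity) (by rw [← hm6]; ring))
    (tendsto_hermiteFn_mul_deriv ν) (tendsto_hermiteFn_energy ν _) |x| (abs_nonneg x)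
  rw [sq_abs] at h1 h2
  rw [habs, hm2, ← hm6]
  constructor
  · set Q := m ^ 2 + |x ^ 2 - m ^ 6| with hQ
    have hQ0 : 0 < Q := by positivity
    apply abs_le_of_sq_le_sq _ (by positivity)
    have e : (Q ^ (-(1:ℝ) / 4)) ^ 2 = (√Q)⁻¹ := by
      rw [← Real.rpow_mul_natCast hQ0.le, Real.sqrt_eq_rpow, ← Real.rpow_neg hQ0.le]
      norm_num
    rw [mul_pow, e, ← div_eq_mul_inv, le_div_iff₀ (Real.sqrt_pos.2 hQ0)]
    linarith
  · intro hx
    apply abs_le_of_sq_le_sq _ (by positivity)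
    refine (h2 hx).trans ?_
    have e : Real.exp (-(1 / 16) * x ^ 2) ^ 2 = Real.exp (-(x ^ 2 / 8)) := by
      rw [← Real.exp_nat_mul]; congr 1; push_cast; ring
    rw [mul_pow, e]
    gcongr
    norm_num
end
end

section
/- There exist constants K ∈ [2,∞) and c ∈ (0,1) such that for every ε ∈ (0,1) there exists C_ε > 0 with the following property: for all (ℓ,m) ∈ ℕ×ℤ with |m| ≤ ℓ and |m| ≥ ε(ℓ+1/2), (a) |Ỹ_{ℓ,m}(x)| ≤ C_ε ((1+ℓ)^{−1} + |x² − a_{ℓ,m}²|)^{−1/4} for all x ∈ [−1,1]; (b) |Ỹ_{ℓ,m}(x)| ≤ C_ε |x|^{−1/2} exp(−c ℓ x²) for all x ∈ [−1,1] with |x| ≥ K a_{ℓ,m}. -/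
open MeasureTheory Set
open scoped ENNReal NNReal

noncomputable section

/-- The Legendre polynomial `P_ℓ(x) = (2^ℓ ℓ!)⁻¹ (d/dx)^ℓ (x²−1)^ℓ`. -/
def legendreP (n : ℕ) (x : ℝ) : ℝ :=
  ((2:ℝ)^n * (Nat.factorial n : ℝ))⁻¹ * iteratedDeriv n (fun y => (y^2 - 1)^n) x

/-- The associated Legendre function `P_ℓ^m` for `0 ≤ m ≤ ℓ`
(on `[-1,1]`, where `√(1-x²)^m = (1-x²)^{m/2}`). -/
def assocP (n m : ℕ) (x : ℝ) : ℝ :=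
  (-1:ℝ)^m * Real.sqrt (1 - x^2) ^ m * iteratedDeriv m (legendreP n) x

/-- The associated Legendre function `P_ℓ^m` for integer `m` with `|m| ≤ ℓ`. -/
def assocPZ (n : ℕ) (m : ℤ) (x : ℝ) : ℝ :=
  if 0 ≤ m then assocP n m.toNat x
  else (-1:ℝ)^m.natAbs *
    ((Nat.factorial (n - m.natAbs) : ℝ) / (Nat.factorial (n + m.natAbs) : ℝ)) *
    assocP n m.natAbs x

/-- `Ỹ_{ℓ,m}(x) = ((2ℓ+1)/(4π) · (ℓ−m)!/(ℓ+m)!)^{1/2} P_ℓ^m(x)`. -/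
def tY (n : ℕ) (m : ℤ) (x : ℝ) : ℝ :=
  Real.sqrt (((2*(n:ℝ)+1) / (4*Real.pi)) *
    ((Nat.factorial ((n : ℤ) - m).toNat : ℝ) / (Nat.factorial ((n : ℤ) + m).toNat : ℝ))) *
  assocPZ n m x

/-- `b_{ℓ,m} = |m|/(ℓ+1/2)`. -/
def blm (n : ℕ) (m : ℤ) : ℝ := |(m : ℝ)| / ((n : ℝ) + 1/2)

/-- `a_{ℓ,m} = (1 − b_{ℓ,m}²)^{1/2}`. -/
def alm (n : ℕ) (m : ℤ) : ℝ := Real.sqrt (1 - blm n m ^ 2)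

theorem energy_antitoneOn {lam μ : ℝ} {U V : ℝ → ℝ} (hlam : 0 < lam)
    (hU : ∀ x ∈ Ioo (-1 : ℝ) 1, HasDerivAt U (V x / (1 - x ^ 2)) x)
    (hV : ∀ x ∈ Ioo (-1 : ℝ) 1,
      HasDerivAt V (-((lam * (1 - x ^ 2) - μ) * U x) / (1 - x ^ 2)) x)
    (hUc : ContinuousOn U (Icc 0 1)) (hVc : ContinuousOn V (Icc 0 1)) :
    AntitoneOn (fun x => (lam * (1 - x ^ 2) - μ) * U x ^ 2 + V x ^ 2) (Icc 0 1) := by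
  refine antitoneOn_of_hasDerivWithinAt_nonpos (f' := fun x => -(2 * lam * x * U x ^ 2))
    (convex_Icc 0 1) (by fun_prop) ?_ ?_
  · intro x hx
    rw [interior_Icc] at hx
    have hx' : x ∈ Ioo (-1 : ℝ) 1 := ⟨by linarith [hx.1], hx.2⟩
    have h := (((((hasDerivAt_id x).pow 2).const_sub 1).const_mul lam).sub_const μ).mul
      ((hU x hx').pow 2) |>.add ((hV x hx').pow 2)
    refine (h.congr_deriv ?_).hasDerivWithinAt
    simp
    field_simp
    ring
  · intro x hx
    rw [interior_Icc] at hx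
    have := mul_pos hlam hx.1
    nlinarith [sq_nonneg (U x), mul_nonneg this.le (sq_nonneg (U x))]

theorem wkb_bound {lam μ x₀ : ℝ} {U V : ℝ → ℝ} (hlam : 0 < lam) (hμ : 0 ≤ μ)
    (hx₀ : 0 ≤ x₀) (hx₁ : x₀ < 1) (hq : 0 < lam * (1 - x₀ ^ 2) - μ)
    (hU : ∀ x ∈ Ioo (-1 : ℝ) 1, HasDerivAt U (V x / (1 - x ^ 2)) x)
    (hV : ∀ x ∈ Ioo (-1 : ℝ) 1,
      HasDerivAt V (-((lam * (1 - x ^ 2) - μ) * U x) / (1 - x ^ 2)) x)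
    (hcut : lam * (1 - x₀ ^ 2) * x₀ ≤ √(lam * (1 - x₀ ^ 2) - μ) ^ 3)
    {x : ℝ} (hx : x ∈ Icc 0 x₀) :
    √(lam * (1 - x ^ 2) - μ) * U x ^ 2 + V x ^ 2 / √(lam * (1 - x ^ 2) - μ) ≤
      2 * Real.exp 1 * (√(lam - μ) * U 0 ^ 2 + V 0 ^ 2 / √(lam - μ)) := by
  set r : ℝ → ℝ := fun x => √(lam * (1 - x ^ 2) - μ) with hr
  set H : ℝ → ℝ := fun x => lam * (1 - x ^ 2) * x / r x ^ 3 with hH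
  set F : ℝ → ℝ := fun x => r x * U x ^ 2 + V x ^ 2 / r x - H x * (U x * V x) with hF
  have hqpos : ∀ y ∈ Icc 0 x₀, 0 < lam * (1 - y ^ 2) - μ := by
    intro y hy
    have : y ^ 2 ≤ x₀ ^ 2 := pow_le_pow_left₀ hy.1 hy.2 2
    nlinarith
  have hrpos : ∀ y ∈ Icc 0 x₀, 0 < r y := fun y hy => Real.sqrt_pos.2 (hqpos y hy)
  have hrsq : ∀ y ∈ Icc 0 x₀, r y ^ 2 = lam * (1 - y ^ 2) - μ :=
    fun y hy => Real.sq_sqrt (hqpos y hy).le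
  have hmem : ∀ y ∈ Icc 0 x₀, y ∈ Ioo (-1 : ℝ) 1 :=
    fun y hy => ⟨by linarith [hy.1], by linarith [hy.2]⟩
  have hp : ∀ y ∈ Icc 0 x₀, 0 < 1 - y ^ 2 := fun y hy => by
    nlinarith [(hmem y hy).1, (hmem y hy).2]
  have hr' : ∀ y ∈ Icc 0 x₀, HasDerivAt r (-(lam * y) / r y) y := by
    intro y hy
    have h := ((((hasDerivAt_id y).pow 2).const_sub 1).const_mul lam).sub_const μ |>.sqrt
      (hqpos y hy).ne'
    refine h.congr_deriv ?_
    have := (hrpos y hy).ne'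
    simp only [hr] at this ⊢
    simp
    field_simp
  have hH' : ∀ y ∈ Icc 0 x₀,
      HasDerivAt H (lam * (r y ^ 2 + 3 * y ^ 2 * μ) / r y ^ 5) y := by
    intro y hy
    have h := (((((hasDerivAt_id y).pow 2).const_sub 1).const_mul lam).mul
      (hasDerivAt_id y)).div ((hr' y hy).pow 3) (pow_ne_zero 3 (hrpos y hy).ne')
    refine h.congr_deriv ?_
    have h0 := (hrpos y hy).ne'
    have h1 : μ = lam * (1 - y ^ 2) - r y ^ 2 := by rw [hrsq y hy]; ring
    rw [h1]
    simp
    field_simp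
    ring
  have hH'nonneg : ∀ y ∈ Icc 0 x₀, 0 ≤ lam * (r y ^ 2 + 3 * y ^ 2 * μ) / r y ^ 5 := by
    intro y hy
    positivity
  have hHmono : MonotoneOn H (Icc 0 x₀) := by
    refine monotoneOn_of_hasDerivWithinAt_nonneg (convex_Icc 0 x₀)
      (fun y hy => (hH' y hy).continuousAt.continuousWithinAt)
      (fun y hy => (hH' y (interior_subset hy)).hasDerivWithinAt)
      (fun y hy => hH'nonneg y (interior_subset hy))
  have hH0 : H 0 = 0 := by simp [hH]
  have hH1 : H x₀ ≤ 1 := by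
    exact (div_le_one (by positivity)).2 hcut
  have hHnonneg : ∀ y ∈ Icc 0 x₀, 0 ≤ H y := fun y hy => by
    rw [← hH0]; exact hHmono ⟨le_rfl, hx₀⟩ hy hy.1
  have hHle : ∀ y ∈ Icc 0 x₀, H y ≤ 1 := fun y hy =>
    (hHmono hy ⟨hx₀, le_rfl⟩ hy.2).trans hH1
  have hUV : ∀ y ∈ Icc 0 x₀, 2 * |U y * V y| ≤ r y * U y ^ 2 + V y ^ 2 / r y := by
    intro y hy
    have h0 := hrpos y hy
    have key : ∀ a b : ℝ, 2 * (a * b) ≤ r y * a ^ 2 + b ^ 2 / r y := by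
      intro a b
      have : r y * a ^ 2 + b ^ 2 / r y - 2 * (a * b) = (r y * a - b) ^ 2 / r y := by
        field_simp; ring
      have h2 : 0 ≤ (r y * a - b) ^ 2 / r y := by positivity
      linarith
    rw [abs_mul]
    simpa using key |U y| |V y|
  have hFG : ∀ y ∈ Icc 0 x₀, r y * U y ^ 2 + V y ^ 2 / r y ≤ 2 * F y := by
    intro y hy
    have h1 : H y * (U y * V y) ≤ |U y * V y| := by
      calc H y * (U y * V y) ≤ H y * |U y * V y| :=
            mul_le_mul_of_nonneg_left (le_abs_self _) (hHnonneg y hy)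
        _ ≤ 1 * |U y * V y| := mul_le_mul_of_nonneg_right (hHle y hy) (abs_nonneg _)
        _ = _ := one_mul _
    have := hUV y hy
    simp only [hF]
    linarith
  have hF' : ∀ y ∈ Icc 0 x₀,
      HasDerivAt F (-(lam * (r y ^ 2 + 3 * y ^ 2 * μ) / r y ^ 5) * (U y * V y)) y := by
    intro y hy
    have hy' := hmem y hy
    have h := (((hr' y hy).mul ((hU y hy').pow 2)).add
      (((hV y hy').pow 2).div (hr' y hy) (hrpos y hy).ne')).sub
      ((hH' y hy).mul ((hU y hy').mul (hV y hy')))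
    refine h.congr_deriv ?_
    have h0 := (hrpos y hy).ne'
    have h1 : μ = lam * (1 - y ^ 2) - r y ^ 2 := by rw [hrsq y hy]; ring
    have h2 := (hp y hy).ne'
    have h3 : lam * (1 - y ^ 2) - μ = r y ^ 2 := (hrsq y hy).symm
    rw [h3]
    simp [hH]
    generalize (lam * (r y ^ 2 + 3 * y ^ 2 * μ)) = K
    field_simp
    ring
  have hΦ : AntitoneOn (fun y => F y * Real.exp (-H y)) (Icc 0 x₀) := by
    refine antitoneOn_of_hasDerivWithinAt_nonpos (convex_Icc 0 x₀)
      (fun y hy => ((hF' y hy).mul (hH' y hy).neg.exp).continuousAt.continuousWithinAt)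
      (fun y hy => ((hF' y (interior_subset hy)).mul
        (hH' y (interior_subset hy)).neg.exp).hasDerivWithinAt) ?_
    intro y hy
    replace hy := interior_subset hy
    have h1 := hH'nonneg y hy
    set K := lam * (r y ^ 2 + 3 * y ^ 2 * μ) / r y ^ 5
    have h2 : -(U y * V y) ≤ F y := by
      linarith [hFG y hy, hUV y hy, neg_abs_le (U y * V y)]
    have : -K * (U y * V y) * Real.exp (-H y) + F y * (Real.exp (-H y) * -K) =
      -(K * Real.exp (-H y) * (F y - -(U y * V y))) := by ring
    rw [Pi.neg_apply, this]
    have : 0 ≤ K * Real.exp (-H y) * (F y - -(U y * V y)) := by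
      positivity
    linarith
  have h1 := hΦ ⟨le_rfl, hx₀⟩ hx hx.1
  simp only [hH0, neg_zero, Real.exp_zero, mul_one] at h1
  have hF0 : F 0 = √(lam - μ) * U 0 ^ 2 + V 0 ^ 2 / √(lam - μ) := by
    simp [hF, hH, hr]
  rw [← hF0]
  have h2 := hFG x hx
  have hFx : 0 ≤ F x := by
    have : 0 ≤ 2 * |U x * V x| := by positivity
    linarith [hUV x hx]
  have h3 : F x ≤ Real.exp 1 * F 0 := by
    calc F x = Real.exp (H x) * (F x * Real.exp (-H x)) := by
          rw [mul_left_comm, ← Real.exp_add]; simp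
      _ ≤ Real.exp 1 * F 0 := by
          apply mul_le_mul (Real.exp_le_exp.2 (hHle x hx)) h1 (by positivity) (by positivity)
  linarith
theorem exists_transition_point {lam μ a : ℝ} (hlam : 0 < lam) (hμ : 0 < μ) (ha : 0 < a)
    (ha2 : lam * a ^ 2 = lam - μ) :
    ∃ x₀ ∈ Ioo 0 a, lam * (1 - x₀ ^ 2) * x₀ = √(lam * (1 - x₀ ^ 2) - μ) ^ 3 := by
  have hc : ContinuousOn (fun x => lam * (1 - x ^ 2) * x - √(lam * (1 - x ^ 2) - μ) ^ 3)
      (Icc 0 a) := by fun_prop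
  have hpos : 0 < lam - μ := by
    rw [← ha2]
    positivity
  have h := intermediate_value_Ioo ha.le hc
  have h0 : (0 : ℝ) ∈ Ioo ((fun x => lam * (1 - x ^ 2) * x - √(lam * (1 - x ^ 2) - μ) ^ 3) 0)
      ((fun x => lam * (1 - x ^ 2) * x - √(lam * (1 - x ^ 2) - μ) ^ 3) a) := by
    have e : lam * (1 - a ^ 2) = μ := by linarith
    constructor
    · have := Real.sqrt_pos.2 hpos
      simp
      positivity
    · simp [e]
      positivity
  obtain ⟨x₀, hx₀, hx⟩ := h h0
  exact ⟨x₀, hx₀, by simpa [sub_eq_zero] using hx⟩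

theorem middle_bound {U V : ℝ → ℝ} {δ s r a x₀ : ℝ} (hδ : 0 < δ) (hr : 0 < r) (hs : 0 ≤ s)
    (hx₀ : 0 ≤ x₀) (hp : ∀ x ∈ Icc x₀ a, δ ≤ 1 - x ^ 2)
    (hU : ∀ x ∈ Ioo (-1 : ℝ) 1, HasDerivAt U (V x / (1 - x ^ 2)) x)
    (hUx₀ : |U x₀| ≤ s) (hVs : ∀ x ∈ Icc x₀ a, |V x| ≤ s * r) (hwidth : (a - x₀) * r ≤ 1)
    {x : ℝ} (hx : x ∈ Icc x₀ a) : |U x| ≤ (1 + 1 / δ) * s := by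
  have hder : ∀ y ∈ Icc x₀ a, HasDerivWithinAt U (V y / (1 - y ^ 2)) (Icc x₀ a) y := by
    intro y hy
    refine (hU y ⟨?_, ?_⟩).hasDerivWithinAt
    · linarith [hy.1]
    · nlinarith [hp y hy, hy.1]
  have hbd : ∀ y ∈ Icc x₀ a, ‖V y / (1 - y ^ 2)‖ ≤ s * r / δ := by
    intro y hy
    have := hp y hy
    rw [Real.norm_eq_abs, abs_div, abs_of_pos (by linarith : 0 < 1 - y ^ 2)]
    exact div_le_div₀ (by positivity) (hVs y hy) hδ this
  have h := (convex_Icc x₀ a).norm_image_sub_le_of_norm_hasDerivWithin_le hder hbd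
    ⟨le_rfl, hx.1.trans hx.2⟩ hx
  rw [Real.norm_eq_abs, Real.norm_eq_abs, abs_of_nonneg (sub_nonneg.2 hx.1)] at h
  have h1 : s * r / δ * (x - x₀) ≤ s / δ := by
    have : (x - x₀) * r ≤ 1 := le_trans (by gcongr; exact hx.2) hwidth
    calc s * r / δ * (x - x₀) = s / δ * ((x - x₀) * r) := by ring
      _ ≤ s / δ * 1 := by gcongr
      _ = _ := mul_one _
  have h2 : |U x| ≤ |U x₀| + |U x - U x₀| := by
    have := abs_add_le (U x₀) (U x - U x₀)
    simpa using this
  have : (1 + 1 / δ) * s = s + s / δ := by ring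
  linarith

theorem outer_bound {lam μ a : ℝ} {U V : ℝ → ℝ} (hlam : 0 < lam) (ha : 0 < a)
    (ha1 : a < 1) (ha2 : lam * a ^ 2 = lam - μ)
    (hU : ∀ x ∈ Ioo (-1 : ℝ) 1, HasDerivAt U (V x / (1 - x ^ 2)) x)
    (hV : ∀ x ∈ Ioo (-1 : ℝ) 1,
      HasDerivAt V (-((lam * (1 - x ^ 2) - μ) * U x) / (1 - x ^ 2)) x)
    (hUc : ContinuousOn U (Icc 0 1)) (hVc : ContinuousOn V (Icc 0 1))
    (hU1 : U 1 = 0) (hV1 : V 1 = 0) {x : ℝ} (hx : x ∈ Icc a 1) :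
    U x ^ 2 ≤ U a ^ 2 ∧
      √(-(lam * (1 - x ^ 2) - μ)) * U x ^ 2 ≤
        |U a * V a| * Real.exp (-(√lam * (x - a) ^ 2)) := by
  have hsub : Icc a 1 ⊆ Icc (0 : ℝ) 1 := Icc_subset_Icc_left ha.le
  have hUc' := hUc.mono hsub
  have hVc' := hVc.mono hsub
  have hsq : √lam ^ 2 = lam := Real.sq_sqrt hlam.le
  have hΨ : AntitoneOn (fun y => -(U y * V y) * Real.exp (√lam * (y - a) ^ 2)) (Icc a 1) := by
    refine antitoneOn_of_hasDerivWithinAt_nonpos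
      (f' := fun y => -((V y ^ 2 - (lam * (1 - y ^ 2) - μ) * U y ^ 2) / (1 - y ^ 2)
        + 2 * √lam * (y - a) * (U y * V y)) * Real.exp (√lam * (y - a) ^ 2))
      (convex_Icc a 1) (by fun_prop) ?_ ?_
    · intro y hy
      rw [interior_Icc] at hy
      have hy' : y ∈ Ioo (-1 : ℝ) 1 := ⟨by linarith [hy.1], hy.2⟩
      have hp : 1 - y ^ 2 ≠ 0 := by nlinarith [hy'.1, hy'.2]
      have h := ((hU y hy').mul (hV y hy')).neg.mul
        ((((hasDerivAt_id y).sub_const a).pow 2).const_mul √lam).exp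
      refine (h.congr_deriv ?_).hasDerivWithinAt
      simp
      field_simp
      ring
    · intro y hy
      rw [interior_Icc] at hy
      have hp : 0 < 1 - y ^ 2 := by nlinarith [hy.1, hy.2]
      set s := √lam * (y - a) with hs
      have hs0 : 0 ≤ s := mul_nonneg (Real.sqrt_nonneg _) (by linarith [hy.1])
      have hs2 : s ^ 2 ≤ -(lam * (1 - y ^ 2) - μ) := by
        nlinarith [mul_pos (mul_pos hlam ha) (sub_pos.2 hy.1)]
      have h1 : 2 * s * |U y * V y| ≤ V y ^ 2 - (lam * (1 - y ^ 2) - μ) * U y ^ 2 := by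
        have h3 : 0 ≤ (|V y| - s * |U y|) ^ 2 := sq_nonneg _
        have h4 : s ^ 2 * U y ^ 2 ≤ -(lam * (1 - y ^ 2) - μ) * U y ^ 2 := by gcongr
        rw [abs_mul]
        rw [sub_sq, mul_pow, sq_abs, sq_abs] at h3
        linarith
      have h2 : 2 * s * |U y * V y| ≤
          (V y ^ 2 - (lam * (1 - y ^ 2) - μ) * U y ^ 2) / (1 - y ^ 2) := by
        rw [le_div_iff₀ hp]
        have : 0 ≤ 2 * s * |U y * V y| := by positivity
        nlinarith
      have h3 : -(2 * s * (U y * V y)) ≤ 2 * s * |U y * V y| := by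
        rw [← mul_neg]
        gcongr
        exact neg_le_abs _
      rw [neg_mul]
      apply neg_nonpos.2
      apply mul_nonneg _ (Real.exp_nonneg _)
      rw [mul_assoc 2 (√lam) (y - a), ← hs]
      linarith
  have h1mem : (1 : ℝ) ∈ Icc a 1 := ⟨ha1.le, le_rfl⟩
  have hD : ∀ y ∈ Icc a 1, 0 ≤ -(U y * V y) := by
    intro y hy
    have := hΨ hy h1mem hy.2
    simp only [hU1, zero_mul, neg_zero] at this
    exact nonneg_of_mul_nonneg_left this (Real.exp_pos _)
  constructor
  · have : AntitoneOn (fun y => U y ^ 2) (Icc a 1) := by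
      refine antitoneOn_of_hasDerivWithinAt_nonpos
        (f' := fun y => -(2 * -(U y * V y) / (1 - y ^ 2))) (convex_Icc a 1) (by fun_prop) ?_ ?_
      · intro y hy
        rw [interior_Icc] at hy
        refine (((hU y ⟨by linarith [hy.1], hy.2⟩).pow 2).congr_deriv ?_).hasDerivWithinAt
        simp
        ring
      · intro y hy
        have h := hD y (interior_subset hy)
        rw [interior_Icc] at hy
        have hp : 0 < 1 - y ^ 2 := by nlinarith [hy.1, hy.2]
        apply neg_nonpos.2
        positivity
    exact this ⟨le_rfl, ha1.le⟩ hx hx.1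
  · have hE := energy_antitoneOn hlam hU hV hUc hVc (hsub hx) (hsub h1mem) hx.2
    simp only [hU1, hV1] at hE
    have hR : 0 ≤ -(lam * (1 - x ^ 2) - μ) := by
      have : a ^ 2 ≤ x ^ 2 := pow_le_pow_left₀ ha.le hx.1 2
      nlinarith
    have h1 : √(-(lam * (1 - x ^ 2) - μ)) * U x ^ 2 ≤ -(U x * V x) := by
      apply abs_le_of_sq_le_sq' _ (hD x hx) |>.2
      rw [mul_pow, Real.sq_sqrt hR]
      nlinarith
    have h2 := hΨ ⟨le_rfl, ha1.le⟩ hx hx.1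
    simp only [sub_self, ne_eq, OfNat.ofNat_ne_zero, not_false_eq_true, zero_pow, mul_zero,
      Real.exp_zero, mul_one] at h2
    rw [Real.exp_neg, ← div_eq_mul_inv, le_div_iff₀ (Real.exp_pos _)]
    refine le_trans (mul_le_mul_of_nonneg_right h1 (Real.exp_nonneg _)) (h2.trans (neg_le_abs _))

set_option maxHeartbeats 1000000 in
theorem legendre_type_bounds {lam μ δ l a : ℝ} {U V : ℝ → ℝ} (hlam : 0 < lam) (hδ : 0 < δ)
    (hδ1 : δ ≤ 1) (hδμ : δ * lam ≤ μ) (hl : 0 < l) (hl1 : l ≤ lam - μ) (hl2 : l ^ 2 ≤ lam)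
    (ha : 0 < a) (ha2 : lam * a ^ 2 = lam - μ)
    (hU : ∀ x ∈ Ioo (-1 : ℝ) 1, HasDerivAt U (V x / (1 - x ^ 2)) x)
    (hV : ∀ x ∈ Ioo (-1 : ℝ) 1,
      HasDerivAt V (-((lam * (1 - x ^ 2) - μ) * U x) / (1 - x ^ 2)) x)
    (hUc : ContinuousOn U (Icc 0 1)) (hVc : ContinuousOn V (Icc 0 1))
    (hU1 : U 1 = 0) (hV1 : V 1 = 0) {B : ℝ}
    (hB : 2 * Real.exp 1 * (√(lam - μ) * U 0 ^ 2 + V 0 ^ 2 / √(lam - μ)) ≤ B)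
    {x : ℝ} (hx : x ∈ Icc 0 1) :
    √(δ / 2 * l) * U x ^ 2 ≤ (1 + 1 / δ) ^ 2 * B ∧
      √|lam * (1 - x ^ 2) - μ| * U x ^ 2 ≤ (1 + 1 / δ) ^ 2 * B ∧
      (a ≤ x → √|lam * (1 - x ^ 2) - μ| * U x ^ 2 ≤
        (1 + 1 / δ) ^ 2 * B * Real.exp (-(√lam * (x - a) ^ 2))) := by
  have hμ : 0 < μ := lt_of_lt_of_le (by positivity) hδμ
  have ha1 : a < 1 := by
    by_contra! h
    have : 1 ≤ a ^ 2 := one_le_pow₀ h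
    nlinarith
  obtain ⟨x₀, ⟨hx₀, hx₀a⟩, hcut⟩ := exists_transition_point hlam hμ ha ha2
  have hq : ∀ y, lam * (1 - y ^ 2) - μ = lam * (a ^ 2 - y ^ 2) := fun y => by linarith
  have hq₀ : 0 < lam * (1 - x₀ ^ 2) - μ := by
    rw [hq]
    have : x₀ ^ 2 < a ^ 2 := pow_lt_pow_left₀ hx₀a hx₀.le two_ne_zero
    nlinarith
  have hwkb : ∀ y ∈ Icc 0 x₀, _ := fun y hy =>
    (wkb_bound hlam hμ.le hx₀.le (hx₀a.trans ha1) hq₀ hU hV hcut.le hy).trans hB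
  have hB0 : 0 ≤ B := le_trans (by positivity) hB
  set r := √(lam * (1 - x₀ ^ 2) - μ) with hr
  have hrpos : 0 < r := Real.sqrt_pos.2 hq₀
  have hr2 : r ^ 2 = lam * (a ^ 2 - x₀ ^ 2) := by rw [hr, Real.sq_sqrt hq₀.le, hq]
  set s := √(B / r) with hs
  have hs0 : 0 ≤ s := Real.sqrt_nonneg _
  have hs2 : s ^ 2 = B / r := Real.sq_sqrt (by positivity)
  have hrs : r * s ^ 2 = B := by rw [hs2]; field_simp
  have hG₀ := hwkb x₀ ⟨hx₀.le, le_rfl⟩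
  have hUx₀ : |U x₀| ≤ s := by
    apply abs_le_of_sq_le_sq _ hs0
    rw [hs2, le_div_iff₀ hrpos]
    have : 0 ≤ V x₀ ^ 2 / r := by positivity
    linarith
  have hE₀ : (lam * (1 - x₀ ^ 2) - μ) * U x₀ ^ 2 + V x₀ ^ 2 ≤ (s * r) ^ 2 := by
    have h1 : (lam * (1 - x₀ ^ 2) - μ) = r ^ 2 := (Real.sq_sqrt hq₀.le).symm
    rw [h1]
    have : r ^ 2 * U x₀ ^ 2 + V x₀ ^ 2 = r * (r * U x₀ ^ 2 + V x₀ ^ 2 / r) := by field_simp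
    rw [this]
    have : (s * r) ^ 2 = r * B := by rw [← hrs]; ring
    rw [this]
    exact mul_le_mul_of_nonneg_left hG₀ hrpos.le
  have hpδ : ∀ y ∈ Icc x₀ a, δ ≤ 1 - y ^ 2 := by
    intro y hy
    have h1 : y ^ 2 ≤ a ^ 2 := pow_le_pow_left₀ (hx₀.le.trans hy.1) hy.2 2
    have h2 : δ * lam ≤ lam * (1 - a ^ 2) := by linarith
    have : δ ≤ 1 - a ^ 2 := by
      by_contra! h
      nlinarith
    linarith
  have hVs : ∀ y ∈ Icc x₀ a, |V y| ≤ s * r := by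
    intro y hy
    apply abs_le_of_sq_le_sq _ (by positivity)
    have h1 := energy_antitoneOn hlam hU hV hUc hVc ⟨hx₀.le, (hx₀a.trans ha1).le⟩
      ⟨hx₀.le.trans hy.1, hy.2.trans ha1.le⟩ hy.1
    have h2 : 0 ≤ (lam * (1 - y ^ 2) - μ) * U y ^ 2 := by
      rw [hq]
      have h1 : y ^ 2 ≤ a ^ 2 := pow_le_pow_left₀ (hx₀.le.trans hy.1) hy.2 2
      positivity
    simp only at h1
    linarith
  have hwidth : (a - x₀) * r ≤ 1 := by
    have h1 : lam * a * ((a - x₀) * r) ≤ lam * a * 1 := by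
      calc lam * a * ((a - x₀) * r) ≤ lam * (a + x₀) * ((a - x₀) * r) := by
            gcongr
            linarith
        _ = r ^ 2 * r := by rw [hr2]; ring
        _ = lam * (1 - x₀ ^ 2) * x₀ := by rw [hcut]; ring
        _ ≤ lam * a * 1 := by
            have : (1 - x₀ ^ 2) * x₀ ≤ 1 * a := by
              apply mul_le_mul _ hx₀a.le hx₀.le zero_le_one
              linarith [sq_nonneg x₀]
            nlinarith
    exact le_of_mul_le_mul_left h1 (by positivity)
  have hmid : ∀ y ∈ Icc x₀ a, |U y| ≤ (1 + 1 / δ) * s := fun y hy =>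
    middle_bound hδ hrpos hs0 hx₀.le hpδ hU hUx₀ hVs hwidth hy
  have hK1 : 1 ≤ 1 + 1 / δ := by
    have : 0 ≤ 1 / δ := by positivity
    linarith
  have hK2 : 1 ≤ (1 + 1 / δ) ^ 2 := one_le_pow₀ hK1
  have hmid2 : ∀ y ∈ Icc x₀ a, r * U y ^ 2 ≤ (1 + 1 / δ) ^ 2 * B := by
    intro y hy
    have h1 : U y ^ 2 ≤ ((1 + 1 / δ) * s) ^ 2 := by
      rw [← sq_abs]
      exact pow_le_pow_left₀ (abs_nonneg _) (hmid y hy) 2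
    calc r * U y ^ 2 ≤ r * ((1 + 1 / δ) * s) ^ 2 := by gcongr
      _ = (1 + 1 / δ) ^ 2 * (r * s ^ 2) := by ring
      _ = _ := by rw [hrs]
  have hin : ∀ y ∈ Icc 0 x₀,
      √(lam * (1 - y ^ 2) - μ) * U y ^ 2 ≤ (1 + 1 / δ) ^ 2 * B := by
    intro y hy
    have h1 := hwkb y hy
    have : 0 ≤ V y ^ 2 / √(lam * (1 - y ^ 2) - μ) := by positivity
    nlinarith
  have hamem : a ∈ Icc x₀ a := ⟨hx₀a.le, le_rfl⟩
  have hall : r * U x ^ 2 ≤ (1 + 1 / δ) ^ 2 * B := by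
    rcases le_total x x₀ with h | h
    · refine le_trans ?_ (hin x ⟨hx.1, h⟩)
      gcongr
      apply Real.sqrt_le_sqrt
      have := pow_le_pow_left₀ hx.1 h 2
      nlinarith
    · rcases le_total x a with h' | h'
      · exact hmid2 x ⟨h, h'⟩
      · refine le_trans ?_ (hmid2 a hamem)
        exact mul_le_mul_of_nonneg_left
          (outer_bound hlam ha ha1 ha2 hU hV hUc hVc hU1 hV1 ⟨h', hx.2⟩).1 hrpos.le
  have hrl : δ / 2 * l ≤ r ^ 2 := by
    rcases le_total (a / 2) x₀ with h | h
    · apply le_of_pow_le_pow_left₀ three_ne_zero (by positivity)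
      have h1 : lam * δ * (a / 2) ≤ r ^ 3 := by
        rw [← hcut]
        have h1 := hpδ x₀ ⟨le_rfl, hx₀a.le⟩
        have h2 : 0 ≤ 1 - x₀ ^ 2 := hδ.le.trans h1
        gcongr
      have h2 : (lam * δ * (a / 2)) ^ 2 ≤ (r ^ 3) ^ 2 := pow_le_pow_left₀ (by positivity) h1 2
      have h3 : (lam * δ * (a / 2)) ^ 2 = δ ^ 2 / 4 * (lam * (lam * a ^ 2)) := by ring
      rw [h3, ha2] at h2
      have h4 : l ^ 2 * l ≤ lam * (lam - μ) := by gcongr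
      calc (δ / 2 * l) ^ 3 = δ ^ 2 / 4 * (l ^ 2 * l) * (δ / 2) := by ring
        _ ≤ δ ^ 2 / 4 * (l ^ 2 * l) * 1 := by gcongr; linarith
        _ ≤ δ ^ 2 / 4 * (lam * (lam - μ)) := by rw [mul_one]; gcongr
        _ ≤ (r ^ 3) ^ 2 := h2
        _ = _ := by ring
    · have h1 : x₀ ^ 2 ≤ (a / 2) ^ 2 := pow_le_pow_left₀ hx₀.le h 2
      have h2 : lam * (3 / 4 * a ^ 2) ≤ r ^ 2 := by
        rw [hr2]
        gcongr
        linarith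
      have h3 : δ / 2 * l ≤ 1 / 2 * l := by gcongr
      have h4 : lam * (3 / 4 * a ^ 2) = 3 / 4 * (lam - μ) := by rw [← ha2]; ring
      linarith
  have hout : a ≤ x → √|lam * (1 - x ^ 2) - μ| * U x ^ 2 ≤
      (1 + 1 / δ) ^ 2 * B * Real.exp (-(√lam * (x - a) ^ 2)) := by
    intro h
    have h1 := (outer_bound hlam ha ha1 ha2 hU hV hUc hVc hU1 hV1 ⟨h, hx.2⟩).2
    have hneg : lam * (1 - x ^ 2) - μ ≤ 0 := by
      rw [hq]
      have := pow_le_pow_left₀ ha.le h 2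
      nlinarith
    rw [abs_of_nonpos hneg]
    refine h1.trans ?_
    gcongr
    rw [abs_mul]
    calc |U a| * |V a| ≤ ((1 + 1 / δ) * s) * (s * r) := by
          gcongr
          · exact hmid a hamem
          · exact hVs a hamem
      _ = (1 + 1 / δ) * (r * s ^ 2) := by ring
      _ = (1 + 1 / δ) * 1 * B := by rw [hrs]; ring
      _ ≤ (1 + 1 / δ) * (1 + 1 / δ) * B := by gcongr
      _ = _ := by ring
  refine ⟨?_, ?_, hout⟩
  · refine le_trans ?_ hall
    gcongr
    exact Real.sqrt_le_iff.2 ⟨hrpos.le, hrl⟩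
  · rcases le_total x a with h' | h'
    · have hnn : 0 ≤ lam * (1 - x ^ 2) - μ := by
        rw [hq]
        have := sub_nonneg.2 (pow_le_pow_left₀ hx.1 h' 2)
        positivity
      rw [abs_of_nonneg hnn]
      rcases le_total x x₀ with h | h
      · exact hin x ⟨hx.1, h⟩
      · refine le_trans ?_ hall
        gcongr
        apply Real.sqrt_le_sqrt
        have := pow_le_pow_left₀ hx₀.le h 2
        nlinarith
    · refine (hout h').trans ?_
      apply mul_le_of_le_one_right (by positivity)
      rw [Real.exp_le_one_iff]
      have : 0 ≤ √lam * (x - a) ^ 2 := by positivity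
      linarith
/-- The `k`-th derivative of `(y² - 1)^n`. -/
noncomputable def rodD (n k : ℕ) : ℝ → ℝ := iteratedDeriv k (fun y : ℝ => (y ^ 2 - 1) ^ n)

theorem hasDerivAt_rodD (n k : ℕ) (x : ℝ) : HasDerivAt (rodD n k) (rodD n (k + 1) x) x := by
  have hc : ContDiff ℝ (k + 1 : ℕ) (fun y : ℝ => (y ^ 2 - 1) ^ n) := by fun_prop
  have h : Differentiable ℝ (rodD n k) :=
    hc.differentiable_iteratedDeriv k (by exact_mod_cast Nat.lt_succ_self k)
  have := (h x).hasDerivAt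
  rwa [show deriv (rodD n k) x = rodD n (k + 1) x by
    simp [rodD, iteratedDeriv_succ]] at this

theorem rodD_first_order (n : ℕ) (x : ℝ) :
    (x ^ 2 - 1) * rodD n 1 x - 2 * n * x * rodD n 0 x = 0 := by
  have h : HasDerivAt (rodD n 0) (n * (x ^ 2 - 1) ^ (n - 1) * (2 * x)) x := by
    simp only [rodD, iteratedDeriv_zero]
    exact ((((hasDerivAt_id x).pow 2).sub_const 1).pow n).congr_deriv (by simp)
  rw [← h.unique (hasDerivAt_rodD n 0 x)]
  cases n with
  | zero => simp
  | succ k => simp [rodD]; ring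

theorem rodD_ode (n k : ℕ) (x : ℝ) :
    (x ^ 2 - 1) * rodD n (k + 2) x + (2 * (k + 1) - 2 * n) * x * rodD n (k + 1) x
      + (k + 1) * (k - 2 * n) * rodD n k x = 0 := by
  induction k generalizing x with
  | zero =>
    have h := ((((hasDerivAt_id x).pow 2).sub_const 1).mul (hasDerivAt_rodD n 1 x)).sub
      ((((hasDerivAt_id x).const_mul (2 * (n : ℝ)))).mul (hasDerivAt_rodD n 0 x))
    have h0 := h.unique ((hasDerivAt_const x (0 : ℝ)).congr_of_eventuallyEq
      (Filter.Eventually.of_forall fun y => by simpa using rodD_first_order n y))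
    simp at h0 ⊢
    linarith
  | succ k ih =>
    have h := (((((hasDerivAt_id x).pow 2).sub_const 1).mul (hasDerivAt_rodD n (k + 2) x)).add
      ((((hasDerivAt_id x).const_mul (2 * ((k : ℝ) + 1) - 2 * n))).mul
        (hasDerivAt_rodD n (k + 1) x))).add
      ((hasDerivAt_rodD n k x).const_mul (((k : ℝ) + 1) * (k - 2 * n)))
    have h0 := h.unique ((hasDerivAt_const x (0 : ℝ)).congr_of_eventuallyEq
      (Filter.Eventually.of_forall fun y => by simpa using ih y))
    simp at h0 ⊢
    linarith

theorem rodD_zero_step (n k : ℕ) :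
    rodD n (k + 2) 0 = (k + 1) * (k - 2 * n) * rodD n k 0 := by
  have := rodD_ode n k 0
  simp at this
  linarith

theorem rodD_odd_zero (n j : ℕ) : rodD n (2 * j + 1) 0 = 0 := by
  induction j with
  | zero => simpa using rodD_first_order n 0
  | succ j ih => rw [show 2 * (j + 1) + 1 = 2 * j + 1 + 2 by ring, rodD_zero_step, ih, mul_zero]

theorem abs_rodD_even_zero {n i j : ℕ} (h : i + j = n) :
    |rodD n (2 * j) 0| * (j.factorial * i.factorial) = (2 * j).factorial * n.factorial := by
  induction j generalizing i with
  | zero =>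
    obtain rfl : i = n := by simpa using h
    simp [rodD]
  | succ j ih =>
    have := ih (i := i + 1) (by omega)
    rw [show 2 * (j + 1) = 2 * j + 2 by ring, rodD_zero_step]
    have hn : (n : ℝ) = i + j + 1 := by rw [← h]; push_cast; ring
    have e : ((2 * j : ℕ) + 1 : ℝ) * ((2 * j : ℕ) - 2 * n) = -((2 * j + 1) * (2 * (i + 1))) := by
      rw [hn]; push_cast; ring
    rw [e, abs_mul, abs_neg, abs_of_nonneg (by positivity)]
    simp only [Nat.factorial_succ] at this ⊢
    push_cast at this ⊢
    linear_combination (2 * (j : ℝ) + 1) * 2 * (j + 1) * this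

theorem rodD_neg (n k : ℕ) (x : ℝ) : |rodD n k (-x)| = |rodD n k x| := by
  have h := iteratedDeriv_comp_neg k (fun y : ℝ => (y ^ 2 - 1) ^ n) x
  simp only [neg_sq] at h
  simp only [rodD]
  rw [h]
  simp [abs_mul]

theorem centralBinom_sq_le (i : ℕ) : (2 * (i : ℝ) + 1) * (i.centralBinom : ℝ) ^ 2 ≤ 16 ^ i := by
  induction i with
  | zero => simp
  | succ i ih =>
    have h : ((i : ℝ) + 1) * ((i + 1).centralBinom : ℝ) = 2 * (2 * i + 1) * i.centralBinom := by
      exact_mod_cast Nat.succ_mul_centralBinom_succ i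
    have h2 : ((i + 1).centralBinom : ℝ) = 2 * (2 * i + 1) * i.centralBinom / (i + 1) := by
      field_simp; linarith
    rw [h2, pow_succ 16]
    have : (2 * ((i + 1 : ℕ) : ℝ) + 1) * (2 * (2 * i + 1) * i.centralBinom / (i + 1)) ^ 2
      = (4 * (2 * i + 3) * (2 * i + 1) / (i + 1) ^ 2) *
        ((2 * (i : ℝ) + 1) * (i.centralBinom : ℝ) ^ 2) := by
      push_cast; field_simp; ring
    rw [this, mul_comm (16 ^ i)]
    apply mul_le_mul _ ih (by positivity) (by norm_num)
    rw [div_le_iff₀ (by positivity)]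
    nlinarith

/-- The function `(1 - x²)^{m/2} (d/dx)^{n+m} (x² - 1)^n`, a multiple of `P_n^m`. -/
def assocU (n m : ℕ) (x : ℝ) : ℝ := √(1 - x ^ 2) ^ m * rodD n (n + m) x

/-- The function `(1 - x²) (d/dx) assocU n m`. -/
def assocV (n m : ℕ) (x : ℝ) : ℝ :=
  √(1 - x ^ 2) ^ m * ((1 - x ^ 2) * rodD n (n + m + 1) x - m * x * rodD n (n + m) x)

theorem continuous_rodD (n k : ℕ) : Continuous (rodD n k) :=
  continuous_iff_continuousAt.2 fun x => (hasDerivAt_rodD n k x).continuousAt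

theorem continuous_assocU (n m : ℕ) : Continuous (assocU n m) := by
  have := continuous_rodD n (n + m)
  unfold assocU
  fun_prop

theorem continuous_assocV (n m : ℕ) : Continuous (assocV n m) := by
  have := continuous_rodD n (n + m)
  have := continuous_rodD n (n + m + 1)
  unfold assocV
  fun_prop

theorem hasDerivAt_sqrt_one_sub_sq_pow (m : ℕ) {x : ℝ} (hx : x ∈ Ioo (-1 : ℝ) 1) :
    HasDerivAt (fun y : ℝ => √(1 - y ^ 2) ^ m) (-(m * x) * √(1 - x ^ 2) ^ m / (1 - x ^ 2)) x := by
  have hp : 0 < 1 - x ^ 2 := by nlinarith [hx.1, hx.2]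
  have h := ((((hasDerivAt_id x).pow 2).const_sub 1).sqrt hp.ne').pow m
  refine h.congr_deriv ?_
  have h2 : 1 - x ^ 2 = √(1 - x ^ 2) ^ 2 := (Real.sq_sqrt hp.le).symm
  cases m with
  | zero => simp
  | succ k =>
    simp
    nth_rewrite 4 [h2]
    field_simp
    ring

theorem hasDerivAt_assocU (n m : ℕ) {x : ℝ} (hx : x ∈ Ioo (-1 : ℝ) 1) :
    HasDerivAt (assocU n m) (assocV n m x / (1 - x ^ 2)) x := by
  have hp : 1 - x ^ 2 ≠ 0 := by nlinarith [hx.1, hx.2]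
  refine ((hasDerivAt_sqrt_one_sub_sq_pow m hx).mul (hasDerivAt_rodD n (n + m) x)).congr_deriv ?_
  unfold assocV
  field_simp
  ring

theorem hasDerivAt_assocV (n m : ℕ) {x : ℝ} (hx : x ∈ Ioo (-1 : ℝ) 1) :
    HasDerivAt (assocV n m)
      (-(((n : ℝ) * (n + 1) * (1 - x ^ 2) - (m : ℝ) ^ 2) * assocU n m x) / (1 - x ^ 2)) x := by
  have hp : 1 - x ^ 2 ≠ 0 := by nlinarith [hx.1, hx.2]
  refine ((hasDerivAt_sqrt_one_sub_sq_pow m hx).mul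
    (((((hasDerivAt_id x).pow 2).const_sub 1).mul (hasDerivAt_rodD n (n + m + 1) x)).sub
      (((hasDerivAt_id x).const_mul (m : ℝ)).mul (hasDerivAt_rodD n (n + m) x)))).congr_deriv ?_
  have h := rodD_ode n (n + m) x
  unfold assocU
  push_cast at h
  simp
  field_simp
  linear_combination (-(1 - x ^ 2) * √(1 - x ^ 2) ^ m) * h

theorem assocU_one (n : ℕ) {m : ℕ} (hm : m ≠ 0) : assocU n m 1 = 0 := by simp [assocU, hm]

theorem assocV_one (n : ℕ) {m : ℕ} (hm : m ≠ 0) : assocV n m 1 = 0 := by simp [assocV, hm]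

theorem assocU_abs_sq (n m : ℕ) (x : ℝ) : assocU n m |x| ^ 2 = assocU n m x ^ 2 := by
  rcases abs_choice x with h | h
  · rw [h]
  · rw [h, assocU, assocU, neg_sq, mul_pow, mul_pow, ← sq_abs (rodD n (n + m) (-x)), rodD_neg,
      sq_abs]

theorem iteratedDeriv_legendreP (n m : ℕ) :
    iteratedDeriv m (legendreP n) =
      fun x => ((2 : ℝ) ^ n * (n.factorial : ℝ))⁻¹ * rodD n (n + m) x := by
  induction m with
  | zero => rfl
  | succ m ih =>
    rw [iteratedDeriv_succ, ih]
    funext x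
    exact ((hasDerivAt_rodD n (n + m) x).const_mul _).deriv

/-- The square of the factor relating `tY` to `assocU`. -/
def normSq (n k : ℕ) : ℝ :=
  (2 * (n : ℝ) + 1) / (4 * Real.pi) * (((n - k).factorial : ℝ) / (n + k).factorial)
    / ((2 : ℝ) ^ n * (n.factorial : ℝ)) ^ 2

theorem normSq_nonneg (n k : ℕ) : 0 ≤ normSq n k := by
  unfold normSq
  positivity

theorem assocP_sq (n m : ℕ) (x : ℝ) :
    assocP n m x ^ 2 = assocU n m x ^ 2 / ((2 : ℝ) ^ n * (n.factorial : ℝ)) ^ 2 := by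
  rw [assocP, iteratedDeriv_legendreP, assocU]
  have h : ((-1 : ℝ) ^ m) ^ 2 = 1 := by rw [← pow_mul, mul_comm, pow_mul]; simp
  simp only [mul_pow, inv_pow] at *
  rw [h]
  field_simp

theorem tY_sq (n : ℕ) (m : ℤ) (hm : m.natAbs ≤ n) (x : ℝ) :
    tY n m x ^ 2 = normSq n m.natAbs * assocU n m.natAbs x ^ 2 := by
  rw [tY, mul_pow, Real.sq_sqrt (by positivity), assocPZ, normSq]
  obtain ⟨k, rfl | rfl⟩ := Int.eq_nat_or_neg m
  · have h1 : ((n : ℤ) - k).toNat = n - k := by omega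
    have h2 : ((n : ℤ) + k).toNat = n + k := by omega
    rw [if_pos (by positivity), h1, h2, Int.toNat_natCast, Int.natAbs_natCast, assocP_sq]
    field_simp
  · rcases Nat.eq_zero_or_pos k with rfl | hk
    · simp [assocP_sq]
      field_simp
    · have h1 : ((n : ℤ) - -(k : ℤ)).toNat = n + k := by omega
      have h2 : ((n : ℤ) + -(k : ℤ)).toNat = n - k := by
        simp at hm
        omega
      have h : ((-1 : ℝ) ^ k) ^ 2 = 1 := by rw [← pow_mul, mul_comm, pow_mul]; simp
      rw [if_neg (by omega), h1, h2, Int.natAbs_neg, Int.natAbs_natCast, mul_pow, mul_pow,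
        assocP_sq, h]
      field_simp

theorem normSq_mul_initial_energy_le {n m : ℕ} (hm : m ≤ n) (hn : n ≠ 0) :
    normSq n m * (√((n : ℝ) * (n + 1) - (m : ℝ) ^ 2) * assocU n m 0 ^ 2
      + assocV n m 0 ^ 2 / √((n : ℝ) * (n + 1) - (m : ℝ) ^ 2)) ≤
        (2 * (n : ℝ) + 1) / (4 * Real.pi) := by
  have hU0 : assocU n m 0 ^ 2 = |rodD n (n + m) 0| ^ 2 := by simp [assocU]
  have hV0 : assocV n m 0 ^ 2 = |rodD n (n + m + 1) 0| ^ 2 := by simp [assocV]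
  have hA : ∀ i j : ℕ, (2 * (i : ℝ) + 1) * (2 * j + 1) *
      (i.centralBinom * j.centralBinom / 4 ^ (i + j)) ^ 2 ≤ 1 := by
    intro i j
    have h := mul_le_mul (centralBinom_sq_le i) (centralBinom_sq_le j)
      (by positivity) (by positivity)
    rw [div_pow, mul_div_assoc', div_le_one (by positivity), ← pow_mul, mul_comm (i + j) 2, pow_mul,
      pow_add]
    norm_num
    linarith
  have hC : ∀ i : ℕ, ((2 * i).factorial : ℝ) = i.centralBinom * (i.factorial : ℝ) ^ 2 := by
    intro i
    have h := Nat.choose_mul_factorial_mul_factorial (show i ≤ 2 * i by omega)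
    rw [show 2 * i - i = i by omega, ← Nat.centralBinom_eq_two_mul_choose] at h
    rw [← h]
    push_cast
    ring
  have hR : ∀ {i j : ℕ}, i + j = n →
      |rodD n (2 * j) 0| = (2 * j).factorial * n.factorial / (j.factorial * i.factorial) := by
    intro i j h
    rw [← abs_rodD_even_zero h]
    field_simp
  have hmn : (m : ℝ) ≤ n := by exact_mod_cast hm
  have hn0 : (0 : ℝ) < n := by exact_mod_cast Nat.pos_of_ne_zero hn
  have hgap : 0 < (n : ℝ) * (n + 1) - (m : ℝ) ^ 2 := by nlinarith
  have hs := Real.sqrt_pos.2 hgap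
  have hs2 := Real.sq_sqrt hgap.le
  set s := √((n : ℝ) * (n + 1) - (m : ℝ) ^ 2)
  suffices h : ((n - m).factorial : ℝ) / (n + m).factorial / ((2 : ℝ) ^ n * n.factorial) ^ 2 *
      (s * assocU n m 0 ^ 2 + assocV n m 0 ^ 2 / s) ≤ 1 by
    have h1 : 0 ≤ (2 * (n : ℝ) + 1) / (4 * Real.pi) := by positivity
    calc _ = (2 * (n : ℝ) + 1) / (4 * Real.pi) *
          (((n - m).factorial : ℝ) / (n + m).factorial / ((2 : ℝ) ^ n * n.factorial) ^ 2 *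
            (s * assocU n m 0 ^ 2 + assocV n m 0 ^ 2 / s)) := by rw [normSq]; ring
      _ ≤ _ := mul_le_of_le_one_right h1 h
  rw [hU0, hV0]
  have hpow : ∀ k : ℕ, ((2 : ℝ) ^ k) ^ 2 = 4 ^ k := fun k => by
    rw [← pow_mul, mul_comm, pow_mul]; norm_num
  rcases Nat.even_or_odd' (n + m) with ⟨j, hj | hj⟩
  · obtain ⟨i, hi⟩ : ∃ i, i + j = n := ⟨n - j, by omega⟩
    have hi2 : n - m = 2 * i := by omega
    rw [hj, rodD_odd_zero, hR hi, hi2]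
    have hnij : (n : ℝ) = i + j := by exact_mod_cast hi.symm
    have hmij : (m : ℝ) = j - i := by
      have : (n : ℝ) + m = 2 * j := by exact_mod_cast hj
      linarith
    have e : ((2 * i).factorial : ℝ) / (2 * j).factorial / ((2 : ℝ) ^ n * n.factorial) ^ 2 *
      (s * ((2 * j).factorial * n.factorial / (j.factorial * i.factorial)) ^ 2 + |0| ^ 2 / s) =
        s * (i.centralBinom * j.centralBinom / 4 ^ (i + j)) := by
      rw [mul_pow ((2 : ℝ) ^ n), hpow, hi, hC i, hC j]
      have := Nat.centralBinom_pos j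
      simp
      field_simp
    rw [e]
    refine le_of_pow_le_pow_left₀ two_ne_zero zero_le_one ?_
    rw [mul_pow, hs2, one_pow]
    refine le_trans ?_ (hA i j)
    gcongr
    rw [hnij, hmij]
    nlinarith
  · obtain ⟨i, hi⟩ : ∃ i, i + (j + 1) = n := ⟨n - (j + 1), by omega⟩
    have hi2 : n - m = 2 * i + 1 := by omega
    rw [hj, rodD_odd_zero, show 2 * j + 1 + 1 = 2 * (j + 1) by ring, hR hi, hi2]
    have hnij : (n : ℝ) = i + (j + 1) := by exact_mod_cast hi.symm
    have hmij : (m : ℝ) = j - i := by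
      have : (n : ℝ) + m = 2 * j + 1 := by exact_mod_cast hj
      linarith
    have hf : ((2 * j + 1).factorial : ℝ) = (2 * (j + 1)).factorial / (2 * (j + 1)) := by
      rw [show 2 * (j + 1) = 2 * j + 1 + 1 by ring, Nat.factorial_succ (2 * j + 1)]
      push_cast
      field_simp
      ring
    have e : ((2 * i + 1).factorial : ℝ) / (2 * j + 1).factorial /
        ((2 : ℝ) ^ n * n.factorial) ^ 2 * (s * |0| ^ 2 +
          ((2 * (j + 1)).factorial * n.factorial / ((j + 1).factorial * i.factorial)) ^ 2 / s) =
        (2 * i + 1) * (2 * (j + 1)) *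
          (i.centralBinom * (j + 1).centralBinom / 4 ^ (i + (j + 1))) / s := by
      rw [mul_pow ((2 : ℝ) ^ n), hpow, hi, hf, Nat.factorial_succ (2 * i)]
      push_cast
      rw [hC i, hC (j + 1)]
      have := Nat.centralBinom_pos (j + 1)
      simp
      field_simp
    rw [e, div_le_one hs]
    refine le_of_pow_le_pow_left₀ two_ne_zero hs.le ?_
    rw [mul_pow, hs2]
    have h1 := hA i (j + 1)
    push_cast at h1
    set A := ((i.centralBinom : ℝ) * (j + 1).centralBinom / 4 ^ (i + (j + 1))) ^ 2
    have hA0 : 0 ≤ A := sq_nonneg _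
    calc ((2 * (i : ℝ) + 1) * (2 * (j + 1))) ^ 2 * A
        ≤ (2 * (i : ℝ) + 1) * (2 * (j + 1)) * ((2 * (i : ℝ) + 1) * (2 * (j + 1) + 1) * A) := by
          have : 0 ≤ (2 * (i : ℝ) + 1) ^ 2 * (2 * (j + 1)) * A := by positivity
          nlinarith
      _ ≤ (2 * (i : ℝ) + 1) * (2 * (j + 1)) := mul_le_of_le_one_right (by positivity) h1
      _ ≤ _ := by
          rw [hnij, hmij]
          nlinarith

theorem alm_sq_sub_le {n k : ℕ} {m : ℤ} (hk : k = m.natAbs) (hn : n ≠ 0) (hkn : k ≤ n) :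
    alm n m ^ 2 = 1 - (k : ℝ) ^ 2 / ((n : ℝ) + 1 / 2) ^ 2 ∧
      1 - (k : ℝ) ^ 2 / ((n : ℝ) * (n + 1)) ≤ alm n m ^ 2 ∧
      alm n m ^ 2 ≤ 1 - (k : ℝ) ^ 2 / ((n : ℝ) * (n + 1)) + 1 / (4 * ((n : ℝ) * (n + 1))) := by
  have hkn' : (k : ℝ) ≤ n := by exact_mod_cast hkn
  have hsq : (k : ℝ) ^ 2 ≤ ((n : ℝ) + 1 / 2) ^ 2 := by gcongr; linarith
  have habs : |(m : ℝ)| = k := by rw [hk, Nat.cast_natAbs, Int.cast_abs]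
  have h : alm n m ^ 2 = 1 - (k : ℝ) ^ 2 / ((n : ℝ) + 1 / 2) ^ 2 := by
    rw [alm, blm, habs, div_pow, Real.sq_sqrt]
    rw [sub_nonneg]
    exact (div_le_one (by positivity)).2 hsq
  refine ⟨h, ?_, ?_⟩
  · rw [h]
    gcongr
    nlinarith
  · rw [h]
    have e : (k : ℝ) ^ 2 / ((n : ℝ) * (n + 1)) - (k : ℝ) ^ 2 / ((n : ℝ) + 1 / 2) ^ 2 =
        (k : ℝ) ^ 2 / ((n : ℝ) + 1 / 2) ^ 2 * (1 / (4 * ((n : ℝ) * (n + 1)))) := by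
      field_simp
      ring
    have : (k : ℝ) ^ 2 / ((n : ℝ) + 1 / 2) ^ 2 * (1 / (4 * ((n : ℝ) * (n + 1)))) ≤
        1 * (1 / (4 * ((n : ℝ) * (n + 1)))) := by
      gcongr
      exact (div_le_one (by positivity)).2 hsq
    linarith

theorem tY_sq_bounds {ε : ℝ} (hε : ε ∈ Ioo (0 : ℝ) 1) {n : ℕ} {m : ℤ} (hn : n ≠ 0)
    (hm0 : m ≠ 0) (hm : m.natAbs ≤ n) (hεm : ε * ((n : ℝ) + 1 / 2) ≤ |(m : ℝ)|) {a : ℝ}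
    (ha : 0 < a) (ha2 : (n : ℝ) * (n + 1) * a ^ 2 = n * (n + 1) - (m.natAbs : ℝ) ^ 2)
    {x : ℝ} (hx : x ∈ Icc (-1 : ℝ) 1) :
    √(ε ^ 2 / 2 * n) * tY n m x ^ 2 ≤ (1 + 1 / ε ^ 2) ^ 2 * (2 * n + 1) ∧
      √((n : ℝ) * (n + 1) * |x ^ 2 - a ^ 2|) * tY n m x ^ 2 ≤
        (1 + 1 / ε ^ 2) ^ 2 * (2 * n + 1) ∧
      (a ≤ |x| → √((n : ℝ) * (n + 1) * |x ^ 2 - a ^ 2|) * tY n m x ^ 2 ≤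
        (1 + 1 / ε ^ 2) ^ 2 * (2 * n + 1) * Real.exp (-(n * (|x| - a) ^ 2))) := by
  obtain ⟨hε0, hε1⟩ := hε
  have hn0 : (0 : ℝ) < n := by exact_mod_cast Nat.pos_of_ne_zero hn
  set k := m.natAbs with hk
  have hk0 : k ≠ 0 := by simpa [hk] using hm0
  have hkn : (k : ℝ) ≤ n := by exact_mod_cast hm
  have habs : |(m : ℝ)| = k := by rw [hk, Nat.cast_natAbs, Int.cast_abs]
  rw [habs] at hεm
  have hμ : ε ^ 2 * ((n : ℝ) * (n + 1)) ≤ (k : ℝ) ^ 2 := by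
    have h1 : (ε * ((n : ℝ) + 1 / 2)) ^ 2 ≤ (k : ℝ) ^ 2 := by gcongr
    have : 0 ≤ ε ^ 2 / 4 := by positivity
    linarith
  have hx' : |x| ∈ Icc (0 : ℝ) 1 := ⟨abs_nonneg x, abs_le.2 hx⟩
  obtain ⟨h1, h2, h3⟩ := legendre_type_bounds (lam := (n : ℝ) * (n + 1)) (μ := (k : ℝ) ^ 2)
    (δ := ε ^ 2) (l := n) (by positivity) (by positivity) (by nlinarith) hμ hn0 (by nlinarith)
    (by nlinarith) ha ha2 (fun x hx => hasDerivAt_assocU n k hx)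
    (fun x hx => hasDerivAt_assocV n k hx) (continuous_assocU n k).continuousOn
    (continuous_assocV n k).continuousOn (assocU_one n hk0) (assocV_one n hk0) le_rfl hx'
  rw [assocU_abs_sq] at h1 h2 h3
  have hN := normSq_nonneg n k
  have hinit := normSq_mul_initial_energy_le hm hn
  set N := normSq n k
  set G := √((n : ℝ) * (n + 1) - (k : ℝ) ^ 2) * assocU n k 0 ^ 2
      + assocV n k 0 ^ 2 / √((n : ℝ) * (n + 1) - (k : ℝ) ^ 2)
  have hNB : N * (2 * Real.exp 1 * G) ≤ 2 * n + 1 := by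
    have he := Real.exp_one_lt_d9
    have hpi := Real.pi_gt_three
    calc N * (2 * Real.exp 1 * G) = 2 * Real.exp 1 * (N * G) := by ring
      _ ≤ 2 * Real.exp 1 * ((2 * (n : ℝ) + 1) / (4 * Real.pi)) := by gcongr
      _ = (2 * n + 1) * (2 * Real.exp 1 / (4 * Real.pi)) := by ring
      _ ≤ (2 * n + 1) * 1 := by
          gcongr
          rw [div_le_one (by positivity)]
          linarith
      _ = _ := mul_one _
  have key : ∀ {c E : ℝ}, 0 ≤ E →
      c * assocU n k x ^ 2 ≤ (1 + 1 / ε ^ 2) ^ 2 * (2 * Real.exp 1 * G) * E →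
      c * tY n m x ^ 2 ≤ (1 + 1 / ε ^ 2) ^ 2 * (2 * n + 1) * E := by
    intro c E hE h
    rw [tY_sq n m hm]
    calc c * (N * assocU n k x ^ 2) = N * (c * assocU n k x ^ 2) := by ring
      _ ≤ N * ((1 + 1 / ε ^ 2) ^ 2 * (2 * Real.exp 1 * G) * E) := by gcongr
      _ = (1 + 1 / ε ^ 2) ^ 2 * (N * (2 * Real.exp 1 * G)) * E := by ring
      _ ≤ _ := by gcongr
  have hq : |(n : ℝ) * (n + 1) * (1 - |x| ^ 2) - (k : ℝ) ^ 2| =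
      (n : ℝ) * (n + 1) * |x ^ 2 - a ^ 2| := by
    have : (n : ℝ) * (n + 1) * (1 - |x| ^ 2) - (k : ℝ) ^ 2 =
        -((n : ℝ) * (n + 1) * (x ^ 2 - a ^ 2)) := by rw [sq_abs]; linarith
    rw [this, abs_neg, abs_mul, abs_of_pos (by positivity : (0 : ℝ) < n * (n + 1))]
  rw [hq] at h2 h3
  refine ⟨?_, ?_, fun hax => ?_⟩
  · simpa using key (E := 1) zero_le_one (by simpa using h1)
  · simpa using key (E := 1) zero_le_one (by simpa using h2)
  · refine (key (Real.exp_nonneg _) (h3 hax)).trans ?_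
    gcongr
    exact Real.le_sqrt_of_sq_le (by nlinarith)

theorem abs_le_sqrt_mul_rpow {t M z : ℝ} {p : ℝ} (hM : 0 ≤ M) (hz : 0 ≤ z)
    (h : t ^ 2 ≤ M * z ^ (2 * p)) : |t| ≤ √M * z ^ p := by
  apply abs_le_of_sq_le_sq _ (by positivity)
  rwa [mul_pow, Real.sq_sqrt hM, ← Real.rpow_natCast (z ^ p), ← Real.rpow_mul hz,
    mul_comm p, Nat.cast_ofNat]

theorem mul_sqrt_weight_le {ε n a b x T K : ℝ} (hε : 0 < ε) (hn : 1 ≤ n) (hK : 0 ≤ K)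
    (hT : 0 ≤ T) (hab : a ≤ b) (hba : b ≤ a + 1 / (4 * (n * (n + 1))))
    (h₁ : √(ε ^ 2 / 2 * n) * T ≤ K * (2 * n + 1))
    (h₂ : √(n * (n + 1) * |x - a|) * T ≤ K * (2 * n + 1)) :
    T * √((1 + n)⁻¹ + |x - b|) ≤ 3 * K * (2 / ε + 1) := by
  set lam : ℝ := n * (n + 1) with hlam
  have hlam0 : 0 < lam := by positivity
  have hsqrt : n ≤ √lam := Real.le_sqrt_of_sq_le (by nlinarith)
  set Z := (1 + n)⁻¹ + |x - b| with hZ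
  have hZle : lam * Z ≤ (2 / ε) ^ 2 * (ε ^ 2 / 2 * n) + lam * |x - a| := by
    have e1 : |x - b| ≤ |x - a| + 1 / (4 * lam) := by
      have := abs_sub_le x a b
      have e2 : |a - b| ≤ 1 / (4 * lam) := by
        rw [abs_sub_comm, abs_of_nonneg (by linarith)]
        linarith
      linarith
    have e3 : lam * Z ≤ lam * ((1 + n)⁻¹ + (|x - a| + 1 / (4 * lam))) := by
      rw [hZ]
      gcongr
    have e4 : lam * ((1 + n)⁻¹ + (|x - a| + 1 / (4 * lam))) = n + lam * |x - a| + 1 / 4 := by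
      rw [mul_add, mul_add, hlam]
      field_simp
      ring
    have e5 : (2 / ε) ^ 2 * (ε ^ 2 / 2 * n) = 2 * n := by
      field_simp
    linarith
  have hsqrtZ : √lam * √Z ≤ 2 / ε * √(ε ^ 2 / 2 * n) + √(lam * |x - a|) := by
    rw [← Real.sqrt_mul hlam0.le]
    refine Real.sqrt_le_iff.2 ⟨by positivity, hZle.trans ?_⟩
    rw [add_sq, mul_pow, Real.sq_sqrt (by positivity), Real.sq_sqrt (by positivity)]
    have : 0 ≤ 2 * (2 / ε * √(ε ^ 2 / 2 * n)) * √(lam * |x - a|) := by positivity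
    linarith
  have hTZ : √lam * (T * √Z) ≤ √lam * (3 * K * (2 / ε + 1)) := by
    calc √lam * (T * √Z) = (√lam * √Z) * T := by ring
      _ ≤ (2 / ε * √(ε ^ 2 / 2 * n) + √(lam * |x - a|)) * T := by gcongr
      _ = 2 / ε * (√(ε ^ 2 / 2 * n) * T) + √(lam * |x - a|) * T := by ring
      _ ≤ 2 / ε * (K * (2 * n + 1)) + K * (2 * n + 1) := by gcongr
      _ = (2 * n + 1) * (K * (2 / ε + 1)) := by ring
      _ ≤ (3 * √lam) * (K * (2 / ε + 1)) := by
          gcongr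
          linarith
      _ = _ := by ring
  exact le_of_mul_le_mul_left hTZ (Real.sqrt_pos.2 hlam0)

theorem le_exp_decay_of_two_mul_le {n a x T K : ℝ} (hn : 1 ≤ n) (hK : 0 ≤ K) (hT : 0 ≤ T)
    (ha : 0 < a) (hax : 2 * a ≤ x)
    (h : √(n * (n + 1) * |x ^ 2 - a ^ 2|) * T ≤
      K * (2 * n + 1) * Real.exp (-(n * (x - a) ^ 2))) :
    T ≤ 6 * K * x⁻¹ * Real.exp (-(1 / 8) * n * x ^ 2) ^ 2 := by
  have hn0 : 0 < n := by linarith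
  have hx0 : 0 < x := by linarith
  have hexp : Real.exp (-(n * (x - a) ^ 2)) ≤ Real.exp (-(1 / 8) * n * x ^ 2) ^ 2 := by
    rw [← Real.exp_nat_mul]
    apply Real.exp_le_exp.2
    have h1 : (x / 2) ^ 2 ≤ (x - a) ^ 2 := by
      gcongr
      linarith
    have := mul_le_mul_of_nonneg_left h1 hn0.le
    push_cast
    linarith
  have hroot : n * x / 2 ≤ √(n * (n + 1) * |x ^ 2 - a ^ 2|) := by
    apply Real.le_sqrt_of_sq_le
    have e1 : (2 * a) ^ 2 ≤ x ^ 2 := by gcongr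
    have e2 : x ^ 2 / 4 ≤ |x ^ 2 - a ^ 2| := by
      refine le_trans ?_ (le_abs_self _)
      linarith [sq_nonneg x]
    calc (n * x / 2) ^ 2 = n * n * (x ^ 2 / 4) := by ring
      _ ≤ n * (n + 1) * |x ^ 2 - a ^ 2| := by
        gcongr
        linarith
  have e1 : n * x / 2 * T ≤
      n * x / 2 * (6 * K * x⁻¹ * Real.exp (-(1 / 8) * n * x ^ 2) ^ 2) := by
    calc n * x / 2 * T ≤ √(n * (n + 1) * |x ^ 2 - a ^ 2|) * T := by gcongr
      _ ≤ K * (2 * n + 1) * Real.exp (-(n * (x - a) ^ 2)) := h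
      _ ≤ K * (3 * n) * Real.exp (-(1 / 8) * n * x ^ 2) ^ 2 := by
          gcongr
          linarith
      _ = _ := by
          field_simp
          ring
  exact le_of_mul_le_mul_left e1 (by positivity)

/-- bounds for spherical harmonics in the Hermite regime
`|m| ≥ ε(ℓ+1/2)`. -/
theorem statement11 :
    ∃ K c : ℝ, 2 ≤ K ∧ 0 < c ∧ c < 1 ∧
      ∀ ε : ℝ, ε ∈ Set.Ioo (0:ℝ) 1 →
        ∃ C : ℝ, 0 < C ∧
          ∀ (n : ℕ) (m : ℤ), m.natAbs ≤ n → ε * ((n:ℝ) + 1/2) ≤ |(m:ℝ)| →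
            ∀ x : ℝ, x ∈ Set.Icc (-1 : ℝ) 1 →
              |tY n m x| ≤ C * ((1 + (n:ℝ))⁻¹ + |x^2 - alm n m ^ 2|) ^ (-(1:ℝ)/4) ∧
              (K * alm n m ≤ |x| →
                |tY n m x| ≤ C * |x| ^ (-(1:ℝ)/2) * Real.exp (-c * (n:ℝ) * x^2)) := by
  refine ⟨2, 1 / 8, le_rfl, by norm_num, by norm_num, fun ε hε => ?_⟩
  have hε0 := hε.1
  have hK0 : 0 ≤ (1 + 1 / ε ^ 2) ^ 2 := by positivity
  set M := 3 * (1 + 1 / ε ^ 2) ^ 2 * (2 / ε + 1) with hM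
  have hM0 : 0 < M := by positivity
  refine ⟨√M, Real.sqrt_pos.2 hM0, fun n m hmn hεm x hx => ?_⟩
  have hm0 : m ≠ 0 := by
    rintro rfl
    have : 0 < ε * ((n : ℝ) + 1 / 2) := by positivity
    rw [Int.cast_zero, abs_zero] at hεm
    linarith
  have hn : n ≠ 0 := by omega
  have hn1 : (1 : ℝ) ≤ n := by exact_mod_cast Nat.one_le_iff_ne_zero.2 hn
  obtain ⟨-, halm1, halm2⟩ := alm_sq_sub_le rfl hn hmn
  have hkn : (m.natAbs : ℝ) ≤ n := by exact_mod_cast hmn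
  have hgap : 0 < 1 - (m.natAbs : ℝ) ^ 2 / ((n : ℝ) * (n + 1)) := by
    rw [sub_pos, div_lt_one (by positivity)]
    nlinarith
  set a := √(1 - (m.natAbs : ℝ) ^ 2 / ((n : ℝ) * (n + 1))) with ha_def
  have ha : 0 < a := Real.sqrt_pos.2 hgap
  have hasq : a ^ 2 = 1 - (m.natAbs : ℝ) ^ 2 / ((n : ℝ) * (n + 1)) := Real.sq_sqrt hgap.le
  have ha2 : (n : ℝ) * (n + 1) * a ^ 2 = n * (n + 1) - (m.natAbs : ℝ) ^ 2 := by
    rw [hasq]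
    field_simp
  obtain ⟨h1, h2, h3⟩ := tY_sq_bounds hε hn hm0 hmn hεm ha ha2 hx
  rw [← hasq] at halm1 halm2
  constructor
  · have hZ0 : 0 < (1 + (n : ℝ))⁻¹ + |x ^ 2 - alm n m ^ 2| := by positivity
    refine abs_le_sqrt_mul_rpow hM0.le hZ0.le ?_
    rw [show (2 : ℝ) * (-1 / 4) = -(1 / 2) by norm_num, Real.rpow_neg hZ0.le,
      ← Real.sqrt_eq_rpow, ← div_eq_mul_inv, le_div_iff₀ (Real.sqrt_pos.2 hZ0)]
    exact mul_sqrt_weight_le hε0 hn1 hK0 (sq_nonneg _) halm1 halm2 h1 h2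
  · intro hKx
    have haalm : a ≤ alm n m := le_of_sq_le_sq halm1 (Real.sqrt_nonneg _)
    have hT := le_exp_decay_of_two_mul_le (x := |x|) (T := tY n m x ^ 2) hn1 hK0
      (sq_nonneg _) ha (by linarith)
      (by rw [sq_abs]; exact h3 (by linarith))
    rw [sq_abs] at hT
    have hM6 : 6 * (1 + 1 / ε ^ 2) ^ 2 ≤ M := by
      have h4 : 2 ≤ 2 / ε := by
        rw [le_div_iff₀ hε0]
        linarith [hε.2]
      rw [hM]
      nlinarith
    apply abs_le_of_sq_le_sq _ (by positivity)
    rw [mul_pow, mul_pow, Real.sq_sqrt hM0.le, ← Real.rpow_natCast (|x| ^ _),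
      ← Real.rpow_mul (abs_nonneg x), show (-1 / 2 : ℝ) * (2 : ℕ) = -1 by norm_num,
      Real.rpow_neg_one]
    refine hT.trans ?_
    gcongr
end
end
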